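/- arXiv:1201.0520 — 3 statements merged into one kernel-verified Lean document; each statement's English description precedes it below -/
import Mathlib

section
/- Let w be a weight on ℝ whose dyadic A_∞ constant [w]_{A_∞^d} := sup_{J ∈ 𝒟} ⟨w⟩_J e^{-⟨log w⟩_J} is finite. Then w belongs to the dyadic class RH_1^d and its constant [w]_{RH_1^d} := sup_{J ∈ 𝒟} ⟨ (w/⟨w⟩_J) log(w/⟨w⟩_J) ⟩_J satisfies [w]_{RH_1^d} ≤ log(16) · [w]_{A_∞^d}. -/
open MeasureTheory Real
open scoped ENNReal

noncomputable section

/-- The average `⟨w⟩_{[a,b]} = (b-a)⁻¹ ∫_a^b w`. -/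
def avg (w : ℝ → ℝ) (a b : ℝ) : ℝ := (b - a)⁻¹ * ∫ x in a..b, w x

/-- A weight: a locally integrable function on `ℝ` that is positive almost everywhere. -/
def IsWeight (w : ℝ → ℝ) : Prop :=
  LocallyIntegrable w volume ∧ ∀ᵐ x : ℝ, 0 < w x

/-- Endpoints of the `k`-th subinterval of `[a,b]` at bisection level `n`; as `n, k` range over
`n : ℕ`, `k < 2^n` these enumerate the family `𝒟(J)` obtained from `J = [a,b]` by repeated
bisection (including `J` itself, for `n = 0`). -/
def subInt (a b : ℝ) (n k : ℕ) : ℝ × ℝ :=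
  (a + k * ((b - a) / 2 ^ n), a + (k + 1) * ((b - a) / 2 ^ n))

/-- Midpoint of an interval. -/
def mid (a b : ℝ) : ℝ := (a + b) / 2

/-- `Δ_I w` for `I = [a,b]`: the difference of the averages of `w` over the two halves of `I`. -/
def delta (w : ℝ → ℝ) (a b : ℝ) : ℝ := avg w a (mid a b) - avg w (mid a b) b

/-- `(1/|J|) Σ_{I ∈ 𝒟(J)} (Δ_I w)² g(⟨w⟩_I) |I|` for `J = [a,b]`. -/
def bellmanSum (w : ℝ → ℝ) (a b : ℝ) (g : ℝ → ℝ) : ℝ :=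
  (b - a)⁻¹ * ∑' n : ℕ, ∑ k ∈ Finset.range (2 ^ n),
    delta w (subInt a b n k).1 (subInt a b n k).2 ^ 2 *
      g (avg w (subInt a b n k).1 (subInt a b n k).2) * ((b - a) / 2 ^ n)

/-- `(1/|J|) Σ_{I ∈ 𝒟(J)} (Δ_I w / ⟨w⟩_I)² g(⟨w⟩_I) |I|` for `J = [a,b]`. -/
def buckleySum (w : ℝ → ℝ) (a b : ℝ) (g : ℝ → ℝ) : ℝ :=
  (b - a)⁻¹ * ∑' n : ℕ, ∑ k ∈ Finset.range (2 ^ n),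
    (delta w (subInt a b n k).1 (subInt a b n k).2 /
        avg w (subInt a b n k).1 (subInt a b n k).2) ^ 2 *
      g (avg w (subInt a b n k).1 (subInt a b n k).2) * ((b - a) / 2 ^ n)

/-- `ℝ≥0∞`-valued version of `buckleySum` (the summands are nonnegative). -/
def buckleySumE (w : ℝ → ℝ) (a b : ℝ) (g : ℝ → ℝ) : ℝ≥0∞ :=
  ENNReal.ofReal ((b - a)⁻¹) * ∑' n : ℕ, ∑ k ∈ Finset.range (2 ^ n),
    ENNReal.ofReal
      ((delta w (subInt a b n k).1 (subInt a b n k).2 /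
          avg w (subInt a b n k).1 (subInt a b n k).2) ^ 2 *
        g (avg w (subInt a b n k).1 (subInt a b n k).2) * ((b - a) / 2 ^ n))

/-- `w` is doubling with constant `D` on the bisection family of `[a,b]`:
`⟨w⟩_I ≤ D ⟨w⟩_{I⁺}` and `⟨w⟩_I ≤ D ⟨w⟩_{I⁻}` for every `I ∈ 𝒟(J)` (including `I = J`). -/
def DoublingOn (D : ℝ) (w : ℝ → ℝ) (a b : ℝ) : Prop :=
  ∀ n : ℕ, ∀ k < 2 ^ n,
    avg w (subInt a b n k).1 (subInt a b n k).2 ≤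
        D * avg w (subInt a b n k).1 (mid (subInt a b n k).1 (subInt a b n k).2) ∧
      avg w (subInt a b n k).1 (subInt a b n k).2 ≤
        D * avg w (mid (subInt a b n k).1 (subInt a b n k).2) (subInt a b n k).2

/-- Endpoints of the dyadic interval `[k·2^{-j}, (k+1)·2^{-j})` of the grid `𝒟`. -/
def dyad (j k : ℤ) : ℝ × ℝ := ((k : ℝ) * (2 : ℝ) ^ (-j), ((k : ℝ) + 1) * (2 : ℝ) ^ (-j))

/-- `w` is dyadically doubling with constant `D`: the average over any dyadic interval is at most
`D` times the average over each of its two dyadic children, i.e. `⟨w⟩_{F(I)} ≤ D ⟨w⟩_I` for every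
`I ∈ 𝒟` with dyadic parent `F(I)`. -/
def DyadicDoubling (D : ℝ) (w : ℝ → ℝ) : Prop :=
  ∀ j k : ℤ,
    avg w (dyad j k).1 (dyad j k).2 ≤
        D * avg w (dyad (j + 1) (2 * k)).1 (dyad (j + 1) (2 * k)).2 ∧
      avg w (dyad j k).1 (dyad j k).2 ≤
        D * avg w (dyad (j + 1) (2 * k + 1)).1 (dyad (j + 1) (2 * k + 1)).2

/-- The dyadic `A_∞` constant `[w]_{A_∞^d} = sup_{J ∈ 𝒟} ⟨w⟩_J e^{-⟨log w⟩_J}`. -/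
def AInfConst (w : ℝ → ℝ) : ℝ≥0∞ :=
  ⨆ j : ℤ, ⨆ k : ℤ, ENNReal.ofReal
    (avg w (dyad j k).1 (dyad j k).2 *
      Real.exp (-avg (fun x => Real.log (w x)) (dyad j k).1 (dyad j k).2))

/-- The constant `[w]_{RH_1^d} = sup_{J ∈ 𝒟} ⟨(w/⟨w⟩_J) log (w/⟨w⟩_J)⟩_J`. -/
def RH1Const (w : ℝ → ℝ) : ℝ≥0∞ :=
  ⨆ j : ℤ, ⨆ k : ℤ, ENNReal.ofReal
    (avg (fun x => w x / avg w (dyad j k).1 (dyad j k).2 *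
        Real.log (w x / avg w (dyad j k).1 (dyad j k).2)) (dyad j k).1 (dyad j k).2)

/-- The coefficient `log 16 · e^b (1 - b)` of `e^y` in `potential b X y`. -/
def supportCoeff (b : ℝ) : ℝ := 4 * Real.log 2 * (Real.exp b * (1 - b))

theorem supportCoeff_mono {b c : ℝ} (hbc : b ≤ c) (hc : c ≤ 0) :
    supportCoeff b ≤ supportCoeff c := by
  have hL := Real.log_pos (by norm_num : (1 : ℝ) < 2)
  have h1 : Real.exp c = Real.exp b * Real.exp (c - b) := by rw [← Real.exp_add]; ring_nf
  have h2 := Real.add_one_le_exp (c - b)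
  have h3 := Real.exp_pos b
  unfold supportCoeff
  refine mul_le_mul_of_nonneg_left ?_ (by positivity)
  rw [h1, mul_assoc]
  refine mul_le_mul_of_nonneg_left ?_ h3.le
  nlinarith [mul_nonneg (sub_nonneg.2 hbc) (neg_nonneg.2 hc)]

theorem supportCoeff_zero : supportCoeff 0 = 4 * Real.log 2 := by simp [supportCoeff]

theorem exp_083_le : Real.exp (83 / 100) ≤ 22934 / 10000 := by
  have := Real.exp_bound' (x := 83 / 100) (by norm_num) (by norm_num) (n := 8) (by norm_num)
  refine this.trans ?_
  norm_num [Finset.sum_range_succ, Nat.factorial]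

theorem le_exp_072 : (20544 / 10000 : ℝ) ≤ Real.exp (72 / 100) := by
  refine le_trans ?_ (Real.sum_le_exp_of_nonneg (x := 72 / 100) (by norm_num) 8)
  norm_num [Finset.sum_range_succ, Nat.factorial]

theorem exp_008_le : Real.exp (2 / 25) ≤ 10833 / 10000 := by
  have := Real.exp_bound' (x := 2 / 25) (by norm_num) (by norm_num) (n := 5) (by norm_num)
  refine this.trans ?_
  norm_num [Finset.sum_range_succ, Nat.factorial]

theorem supportCoeff_sub_le {b : ℝ} (h1 : -83 / 100 ≤ b) (h2 : b ≤ -72 / 100) :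
    supportCoeff b - b ≤ 3043 / 1000 := by
  obtain ⟨d, rfl⟩ : ∃ d, b = -(72 / 100 + d) := ⟨-b - 72 / 100, by ring⟩
  have hd0 : 0 ≤ d := by linarith
  have hd1 : d ≤ 11 / 100 := by linarith
  have hE : Real.exp (-(72 / 100 + d)) * (Real.exp (72 / 100) * Real.exp d) = 1 := by
    rw [← Real.exp_add, ← Real.exp_add]; simp
  have hd := Real.sum_le_exp_of_nonneg hd0 4
  norm_num [Finset.sum_range_succ, Nat.factorial] at hd
  have hT : (20544 / 10000 : ℝ) * (1 + d + d ^ 2 / 2 + d ^ 3 / 6) ≤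
      Real.exp (72 / 100) * Real.exp d :=
    mul_le_mul le_exp_072 hd (by positivity) (Real.exp_pos _).le
  have hx := Real.exp_pos (-(72 / 100 + d))
  set x := Real.exp (-(72 / 100 + d))
  have hx1 : x * ((20544 / 10000 : ℝ) * (1 + d + d ^ 2 / 2 + d ^ 3 / 6)) ≤ 1 :=
    (mul_le_mul_of_nonneg_left hT hx.le).trans_eq hE
  have hL := Real.log_two_lt_d9
  have hL0 := Real.log_two_gt_d9
  have hpoly : 2.7725888 * (172 / 100 + d) ≤
      (2323 / 1000 - d) * ((20544 / 10000 : ℝ) * (1 + d + d ^ 2 / 2 + d ^ 3 / 6)) := by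
    nlinarith [mul_nonneg hd0 (sub_nonneg.2 hd1), sq_nonneg (d - 9 / 100), mul_nonneg hd0 (sq_nonneg (d - 9/100)), mul_nonneg (mul_nonneg hd0 hd0) (sub_nonneg.2 hd1), mul_nonneg (mul_nonneg hd0 hd0) (mul_nonneg hd0 (sub_nonneg.2 hd1))]
  have h3 : 2.7725888 * (172 / 100 + d) * x ≤ 2323 / 1000 - d := by
    have := mul_le_mul_of_nonneg_right hpoly hx.le
    have h5 := mul_le_mul_of_nonneg_left hx1 (by linarith : (0 : ℝ) ≤ 2323 / 1000 - d)
    linarith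
  have h4 : 4 * Real.log 2 * (x * (172 / 100 + d)) ≤ 2.7725888 * (x * (172 / 100 + d)) :=
    mul_le_mul_of_nonneg_right (by linarith) (by positivity)
  unfold supportCoeff
  change 4 * Real.log 2 * (x * (1 - -(72 / 100 + d))) - -(72 / 100 + d) ≤ _
  linarith

theorem supportCoeff_sub_le_of_le {b : ℝ} (h1 : -142 / 100 ≤ b) (h2 : b ≤ -83 / 100) :
    supportCoeff b - b ≤ supportCoeff (-83 / 100) - (-83 / 100) := by
  obtain ⟨d, rfl⟩ : ∃ d, b = -(83 / 100) - d := ⟨-b - 83 / 100, by ring⟩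
  have hd0 : 0 ≤ d := by linarith
  have hd1 : d ≤ 59 / 100 := by linarith
  have hd := Real.sum_le_exp_of_nonneg hd0 6
  norm_num [Finset.sum_range_succ, Nat.factorial] at hd
  have hE : Real.exp (-(83 / 100) - d) * Real.exp d = Real.exp (-(83 / 100)) := by
    rw [← Real.exp_add]; simp
  have hK : Real.exp (-(83 / 100)) * Real.exp (83 / 100) = 1 := by
    rw [← Real.exp_add]; simp
  have hK1 := exp_083_le
  have hx := Real.exp_pos (-(83 / 100) - d)
  have hk := Real.exp_pos (-(83 / 100))
  have hL0 := Real.log_two_gt_d9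
  set k := Real.exp (-(83 / 100))
  set x := Real.exp (-(83 / 100) - d)
  set T := Real.exp d
  have hak : 1 ≤ 8272 / 10000 * (4 * Real.log 2 * k) := by nlinarith
  have hpoly : 183 / 100 + d ≤ (183 / 100 - 8272 / 10000 * d) *
      (1 + d + d ^ 2 / 2 + d ^ 3 / 6 + d ^ 4 / 24 + d ^ 5 / 120) := by
    have hd2 : d ^ 2 ≤ 349 / 1000 := by nlinarith
    have hd3 : d ^ 3 ≤ 206 / 1000 := by nlinarith [mul_nonneg hd0 (sub_nonneg.2 hd2)]
    have hd4 : d ^ 4 ≤ 122 / 1000 := by nlinarith [mul_nonneg hd0 (sub_nonneg.2 hd3)]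
    have hB : -3 / 1000 ≤ (915 / 1000 - 8272 / 10000) + (183 / 600 - 8272 / 20000) * d +
        (183 / 2400 - 8272 / 60000) * d ^ 2 + (183 / 12000 - 8272 / 240000) * d ^ 3 -
        8272 / 1200000 * d ^ 4 := by
      linarith
    have := mul_nonneg (mul_nonneg hd0 hd0) (sub_nonneg.2 hB)
    nlinarith
  have h3 : 183 / 100 + d ≤ (183 / 100 - 8272 / 10000 * d) * T :=
    hpoly.trans (mul_le_mul_of_nonneg_left hd (by linarith))
  have h4 : (183 / 100 + d) * x ≤ (183 / 100 - 8272 / 10000 * d) * k := by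
    have := mul_le_mul_of_nonneg_right h3 hx.le
    rw [← hE]; linarith
  have h5 := mul_le_mul_of_nonneg_left h4 (by linarith : 0 ≤ 4 * Real.log 2)
  have h6 := mul_le_mul_of_nonneg_left hak hd0
  unfold supportCoeff
  rw [show (-83 / 100 : ℝ) = -(83 / 100) by norm_num]
  change 4 * Real.log 2 * (x * (1 - (-(83 / 100) - d))) - (-(83 / 100) - d) ≤
    4 * Real.log 2 * (k * (1 - -(83 / 100))) - -(83 / 100)
  linarith

theorem two_le_supportCoeff {b : ℝ} (h1 : -83 / 100 ≤ b) (h2 : b ≤ 0) : 2 ≤ supportCoeff b := by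
  refine le_trans ?_ (supportCoeff_mono h1 h2)
  have hK : Real.exp (-83 / 100) * Real.exp (83 / 100) = 1 := by
    rw [← Real.exp_add]; norm_num
  have hK1 := exp_083_le
  have hk := Real.exp_pos (-83 / 100)
  have hL0 := Real.log_two_gt_d9
  unfold supportCoeff
  nlinarith

theorem supportCoeff_nonneg {b : ℝ} (h : b ≤ 0) : 0 ≤ supportCoeff b := by
  have hL := Real.log_pos (by norm_num : (1 : ℝ) < 2)
  have h3 := Real.exp_pos b
  have : 0 ≤ 1 - b := by linarith
  unfold supportCoeff
  positivity

theorem supportCoeff_le_zero (x : ℝ) : supportCoeff x ≤ supportCoeff 0 := by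
  have hL := Real.log_pos (by norm_num : (1 : ℝ) < 2)
  have h1 := Real.add_one_le_exp (-x)
  have h2 : Real.exp x * Real.exp (-x) = 1 := by rw [← Real.exp_add]; simp
  have h3 := Real.exp_pos x
  unfold supportCoeff
  refine mul_le_mul_of_nonneg_left ?_ (by positivity)
  simp only [Real.exp_zero]
  nlinarith

theorem le_supportCoeff_neg_two_div :
    4 * (Real.log 2 * (9969 / 10000)) ≤ supportCoeff (-(2 / 25)) := by
  have hK : Real.exp (-(2 / 25)) * Real.exp (2 / 25) = 1 := by
    rw [← Real.exp_add]; norm_num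
  have hK1 := exp_008_le
  have hk := Real.exp_pos (-(2 / 25))
  have hL := Real.log_pos (by norm_num : (1 : ℝ) < 2)
  unfold supportCoeff
  rw [mul_assoc 4]
  refine mul_le_mul_of_nonneg_left (mul_le_mul_of_nonneg_left ?_ hL.le) (by norm_num)
  nlinarith

theorem supportCoeff_split_far {b δ s r : ℝ} (hb : -83 / 100 ≤ b) (hb0 : b ≤ 0)
    (hδ : Real.log 2 ≤ δ) (hr : 0 ≤ r) (hsr : s + r ≤ 2) :
    supportCoeff b - b * ((s + r) / 2) ≤
      (supportCoeff b * Real.exp δ - (b + δ) * s +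
        (supportCoeff 0 * Real.exp (-δ) - (0 - δ) * r)) / 2 := by
  have hL := Real.log_two_gt_d9
  have hA := two_le_supportCoeff hb hb0
  rw [supportCoeff_zero]
  have hv : Real.exp δ * Real.exp (-δ) = 1 := by rw [← Real.exp_add]; simp
  have hv2 : 2 ≤ Real.exp δ := by
    rw [← Real.exp_log (by norm_num : (0 : ℝ) < 2)]; exact Real.exp_le_exp.2 hδ
  have hlog : δ - Real.log 2 ≤ Real.exp δ / 2 - 1 := by
    have := Real.add_one_le_exp (δ - Real.log 2)
    rw [Real.exp_sub, Real.exp_log (by norm_num)] at this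
    linarith
  have hW := Real.exp_pos (-δ)
  set v := Real.exp δ
  set W := Real.exp (-δ)
  set A := supportCoeff b
  have h1 : 0 ≤ (A - 2) * (v / 2 - 1) := mul_nonneg (by linarith) (by linarith)
  have h2 : 0 ≤ r * (b + 2 * δ) := mul_nonneg hr (by linarith)
  have h3 : 0 ≤ δ * (2 - r - s) := mul_nonneg (by linarith) (by linarith)
  have h4 : 0 ≤ (v / 2 - 1) + 2 * Real.log 2 * W - Real.log 2 := by
    have hW1 : W ≤ 1 / 2 := by nlinarith
    have : v / 2 - 1 = (v / 2) * (1 - 2 * W) := by linarith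
    have hL1 := Real.log_two_lt_d9
    have : 0 ≤ (v / 2 - Real.log 2) * (1 - 2 * W) := mul_nonneg (by linarith) (by linarith)
    linarith
  linarith

theorem log_one_sub_le {e : ℝ} (h0 : 0 ≤ e) (h1 : e ≤ 1 / 10) :
    Real.log (1 - e) ≤ -e - e ^ 2 / 2 := by
  have h := Real.abs_log_sub_add_sum_range_le (x := e) (by rw [abs_of_nonneg h0]; linarith) 3
  rw [abs_of_nonneg h0] at h
  have h2 := (abs_le.1 h).2
  norm_num [Finset.sum_range_succ] at h2
  have h3 : e ^ 4 / (1 - e) ≤ e ^ 3 / 3 := by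
    rw [div_le_iff₀ (by linarith)]
    have : 0 ≤ e ^ 3 := by positivity
    nlinarith
  linarith

theorem supportCoeff_split_mid_aux {A b c δ e s r W M : ℝ} (hv : s ≤ 2 * (1 - e)) (hr : 0 ≤ r)
    (hsr : s + r ≤ 2) (hδ : 0 ≤ δ)
    (h1 : 0 ≤ b + c + δ → e * A + (1 - e) * δ ≤ M * W / 2)
    (h2 : b + c + δ ≤ 0 → 0 ≤ 2 * δ + b + c ∧ e * (A - b - c) + (1 - 2 * e) * δ ≤ M * W / 2) :
    A - b * ((s + r) / 2) ≤
      (A * (2 * (1 - e)) - (b + δ) * s + (M * W - (-c - δ) * r)) / 2 := by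
  rcases le_total 0 (b + c + δ) with h | h
  · have := h1 h
    have h3 := mul_nonneg hr h
    have h4 := mul_nonneg hδ (sub_nonneg.2 hv)
    linarith
  · obtain ⟨h3, h4⟩ := h2 h
    have h5 := mul_nonneg (sub_nonneg.2 hv) h3
    have h6 := mul_nonneg (neg_nonneg.2 h) (sub_nonneg.2 hsr)
    linarith

theorem le_exp_059 : (1803 / 1000 : ℝ) ≤ Real.exp (59 / 100) := by
  refine le_trans ?_ (Real.sum_le_exp_of_nonneg (x := 59 / 100) (by norm_num) 8)
  norm_num [Finset.sum_range_succ, Nat.factorial]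

theorem supportCoeff_split_mid {b δ s r : ℝ} (hb : -83 / 100 ≤ b)
    (hbδ : b - δ ≤ -142 / 100) (hδ : δ ≤ Real.log 2) (hr : 0 ≤ r)
    (hs : s ≤ Real.exp δ) (hsr : s + r ≤ 2) :
    ∃ c : ℝ, 0 ≤ c ∧ c ≤ 2 / 25 ∧
    supportCoeff b - b * ((s + r) / 2) ≤
      (supportCoeff b * Real.exp δ - (b + δ) * s +
        (supportCoeff (-c) * Real.exp (-δ) - (-c - δ) * r)) / 2 := by
  have hL := Real.log_two_gt_d9
  have hL' := Real.log_two_lt_d9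
  have hδ1 : 59 / 100 ≤ δ := by linarith
  have hA := supportCoeff_sub_le hb (by linarith)
  have hv1 : 1803 / 1000 ≤ Real.exp δ := le_exp_059.trans (Real.exp_le_exp.2 hδ1)
  have hv2 : Real.exp δ ≤ 2 := by
    rw [← Real.exp_log (by norm_num : (0 : ℝ) < 2)]; exact Real.exp_le_exp.2 hδ
  have hvW : Real.exp δ * Real.exp (-δ) = 1 := by rw [← Real.exp_add]; simp
  obtain ⟨e, he⟩ : ∃ e, Real.exp δ = 2 * (1 - e) := ⟨1 - Real.exp δ / 2, by ring⟩
  have he0 : 0 ≤ e := by linarith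
  have he1 : e ≤ 985 / 10000 := by linarith
  have hδ2 : δ ≤ Real.log 2 - e - e ^ 2 / 2 := by
    have h := log_one_sub_le he0 (by linarith)
    have h2 := congrArg Real.log he
    rw [Real.log_exp, Real.log_mul (by norm_num) (by linarith)] at h2
    linarith
  rw [he] at hvW hs ⊢
  have hW : (1 + e + e ^ 2 + e ^ 3) / 2 ≤ Real.exp (-δ) := by
    have : 0 ≤ e ^ 4 := by positivity
    refine le_of_mul_le_mul_left ?_ (by linarith : 0 < 2 * (1 - e))
    rw [hvW]
    linarith
  generalize Real.exp (-δ) = W at *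
  generalize supportCoeff b = A at *
  have he2 : 0 ≤ e ^ 2 := by positivity
  have he3 : 0 ≤ e ^ 3 := by positivity
  generalize hl : Real.log 2 = L at *
  by_cases hsmall : e ≤ 35 / 1000
  · refine ⟨0, le_rfl, by norm_num, supportCoeff_split_mid_aux hs hr hsr (by linarith) ?_ ?_⟩
    · intro h; linarith
    · intro _
      refine ⟨by linarith, ?_⟩
      rw [neg_zero, supportCoeff_zero, hl]
      have h1 := mul_le_mul_of_nonneg_left hW (by linarith : 0 ≤ L)
      have h2 := mul_le_mul_of_nonneg_left hA he0
      have h3 := mul_le_mul_of_nonneg_left hδ2 (by linarith : 0 ≤ 1 - 2 * e)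
      have h4 := mul_nonneg he0 (sub_nonneg.2 hL.le)
      have h5 := mul_nonneg he2 (sub_nonneg.2 hL.le)
      have h6 := mul_nonneg he3 (sub_nonneg.2 hL.le)
      have h7 := mul_nonneg he0 (sub_nonneg.2 hsmall)
      have h8 := mul_nonneg he2 (sub_nonneg.2 hsmall)
      linarith
  · push Not at hsmall
    have hM := le_supportCoeff_neg_two_div
    rw [hl] at hM
    have hMW : 2 * (L * (9969 / 10000)) * (1 + e + e ^ 2 + e ^ 3) ≤
        supportCoeff (-(2 / 25)) * W := by
      have := mul_le_mul hM hW (by positivity) (supportCoeff_nonneg (by norm_num))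
      linarith
    have h4 := mul_nonneg he0 (sub_nonneg.2 hL.le)
    have h5 := mul_nonneg he2 (sub_nonneg.2 hL.le)
    have h6 := mul_nonneg he3 (sub_nonneg.2 hL.le)
    have h7 := mul_nonneg (sub_nonneg.2 hsmall.le) (sub_nonneg.2 he1)
    have h8 := mul_nonneg he0 h7
    have h2 := mul_le_mul_of_nonneg_left hA he0
    refine ⟨2 / 25, by norm_num, le_rfl,
      supportCoeff_split_mid_aux hs hr hsr (by linarith) ?_ ?_⟩
    · intro _
      have h3 := mul_le_mul_of_nonneg_left hδ2 (by linarith : 0 ≤ 1 - e)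
      have h9 := mul_le_mul_of_nonneg_left (hbδ.trans_eq' rfl) he0
      have h10 := mul_le_mul_of_nonneg_left hδ2 he0
      linarith
    · intro _
      have h3 := mul_le_mul_of_nonneg_left hδ2 (by linarith : 0 ≤ 1 - 2 * e)
      refine ⟨by linarith, ?_⟩
      linarith

theorem supportCoeff_split_near {b δ : ℝ} (s r : ℝ) :
    supportCoeff b - b * ((s + r) / 2) =
      (supportCoeff (b - δ) * Real.exp δ - (b - δ + δ) * s +
        (supportCoeff (b + δ) * Real.exp (-δ) - (b + δ - δ) * r)) / 2 := by
  have h1 : Real.exp (b - δ) * Real.exp δ = Real.exp b := by rw [← Real.exp_add]; ring_nf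
  have h2 : Real.exp (b + δ) * Real.exp (-δ) = Real.exp b := by rw [← Real.exp_add]; ring_nf
  unfold supportCoeff
  linear_combination (-2 * Real.log 2 * (1 - (b - δ))) * h1 +
    (-2 * Real.log 2 * (1 - (b + δ))) * h2

/-- The dyadic one-step inequality for the potentials, normalized so that the parent has `y = 0`,
with the children at `y = δ` and `y = -δ`. -/
theorem exists_supportCoeff_split {b δ s r : ℝ} (hb : -142 / 100 ≤ b) (hb0 : b ≤ 0) (hδ : 0 ≤ δ)
    (hr : 0 ≤ r) (hs : s ≤ Real.exp δ) (hsr : s + r ≤ 2) :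
    ∃ b₁ ∈ Set.Icc (-142 / 100 : ℝ) 0, ∃ b₂ ∈ Set.Icc (-142 / 100 : ℝ) 0,
      supportCoeff b - b * ((s + r) / 2) ≤
        (supportCoeff b₁ * Real.exp δ - (b₁ + δ) * s +
          (supportCoeff b₂ * Real.exp (-δ) - (b₂ - δ) * r)) / 2 := by
  wlog h83 : -83 / 100 ≤ b generalizing b
  · push Not at h83
    obtain ⟨b₁, h₁, b₂, h₂, h⟩ := this (b := -83 / 100) (by norm_num) (by norm_num) le_rfl
    refine ⟨b₁, h₁, b₂, h₂, le_trans ?_ h⟩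
    have := supportCoeff_sub_le_of_le hb h83.le
    nlinarith
  rcases le_total (-142 / 100) (b - δ) with h | h
  · rcases le_total (b + δ) 0 with h' | h'
    · exact ⟨b - δ, ⟨h, by linarith⟩, b + δ, ⟨by linarith, h'⟩,
        (supportCoeff_split_near s r).le⟩
    · refine ⟨b - δ, ⟨h, by linarith⟩, 0, ⟨by norm_num, le_rfl⟩,
        (supportCoeff_split_near (δ := δ) s r).le.trans ?_⟩
      have h1 := mul_le_mul_of_nonneg_right (supportCoeff_le_zero (b + δ)) (Real.exp_pos (-δ)).le
      have h2 := mul_nonneg h' hr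
      linarith
  · rcases le_total (Real.log 2) δ with h' | h'
    · exact ⟨b, ⟨hb, hb0⟩, 0, ⟨by norm_num, le_rfl⟩, supportCoeff_split_far h83 hb0 h' hr hsr⟩
    · obtain ⟨c, hc0, hc1, hc⟩ := supportCoeff_split_mid h83 h h' hr hs hsr
      exact ⟨b, ⟨hb, hb0⟩, -c, ⟨by linarith, by linarith⟩, hc⟩

/-- A family of functions, indexed by `b` and affine in `X`, whose supremum over
`b ∈ [-142/100, 0]` is dyadically convex on `{(X, y) | 0 ≤ X ≤ e^y}`. The pair `(X, y)` stands for
`(⟨w⟩_J, ⟨log w⟩_J + log Q)`, where `Q` bounds the dyadic `A_∞` constant of `w`. -/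
def potential (b X y : ℝ) : ℝ := supportCoeff b * Real.exp y - (b + y) * X

theorem exists_potential_le_of_le {b X₁ X₂ y₁ y₂ : ℝ} (hb : b ∈ Set.Icc (-142 / 100 : ℝ) 0)
    (hX₂ : 0 ≤ X₂) (h₁ : X₁ ≤ Real.exp y₁)
    (h : (X₁ + X₂) / 2 ≤ Real.exp ((y₁ + y₂) / 2)) (hy : y₂ ≤ y₁) :
    ∃ b₁ ∈ Set.Icc (-142 / 100 : ℝ) 0, ∃ b₂ ∈ Set.Icc (-142 / 100 : ℝ) 0,
      potential b ((X₁ + X₂) / 2) ((y₁ + y₂) / 2) ≤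
        (potential b₁ X₁ y₁ + potential b₂ X₂ y₂) / 2 := by
  obtain ⟨y, δ, rfl, rfl⟩ : ∃ y δ, y₁ = y + δ ∧ y₂ = y + -δ :=
    ⟨(y₁ + y₂) / 2, (y₁ - y₂) / 2, by ring, by ring⟩
  have hy0 : (y + δ + (y + -δ)) / 2 = y := by ring
  rw [hy0] at h ⊢
  have hE := Real.exp_pos y
  rw [Real.exp_add] at h₁
  obtain ⟨b₁, hb₁, b₂, hb₂, H⟩ := exists_supportCoeff_split (δ := δ) (s := X₁ / Real.exp y)
    (r := X₂ / Real.exp y) hb.1 hb.2 (by linarith) (by positivity)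
    (by rw [div_le_iff₀ hE]; linarith) (by rw [← add_div, div_le_iff₀ hE]; linarith)
  refine ⟨b₁, hb₁, b₂, hb₂, ?_⟩
  have H' := mul_le_mul_of_nonneg_left H hE.le
  have e1 : Real.exp y * (X₁ / Real.exp y) = X₁ := by field_simp
  have e2 : Real.exp y * (X₂ / Real.exp y) = X₂ := by field_simp
  unfold potential
  rw [Real.exp_add, Real.exp_add]
  set E := Real.exp y
  generalize X₁ / E = s at *
  generalize X₂ / E = r at *
  subst e1 e2
  linarith

theorem exists_potential_le {b X₁ X₂ y₁ y₂ : ℝ} (hb : b ∈ Set.Icc (-142 / 100 : ℝ) 0)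
    (hX₁ : 0 ≤ X₁) (hX₂ : 0 ≤ X₂) (h₁ : X₁ ≤ Real.exp y₁) (h₂ : X₂ ≤ Real.exp y₂)
    (h : (X₁ + X₂) / 2 ≤ Real.exp ((y₁ + y₂) / 2)) :
    ∃ b₁ ∈ Set.Icc (-142 / 100 : ℝ) 0, ∃ b₂ ∈ Set.Icc (-142 / 100 : ℝ) 0,
      potential b ((X₁ + X₂) / 2) ((y₁ + y₂) / 2) ≤
        (potential b₁ X₁ y₁ + potential b₂ X₂ y₂) / 2 := by
  rcases le_total y₂ y₁ with hy | hy
  · exact exists_potential_le_of_le hb hX₂ h₁ h hy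
  · rw [add_comm X₁, add_comm y₁] at h ⊢
    obtain ⟨b₂, hb₂, b₁, hb₁, H⟩ := exists_potential_le_of_le hb hX₁ h₂ h hy
    exact ⟨b₁, hb₁, b₂, hb₂, H.trans_eq (by ring)⟩

theorem mul_log_le_sub_potential {b X y : ℝ} (hb : b ∈ Set.Icc (-142 / 100 : ℝ) 0)
    (hX : 0 < X) (h : X ≤ Real.exp y) :
    X * Real.log X ≤ supportCoeff 0 * Real.exp y + 2 * X - potential b X y := by
  have h1 := mul_le_mul_of_nonneg_right (supportCoeff_le_zero b) (Real.exp_pos y).le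
  have h2 : Real.log X ≤ y := (Real.log_le_iff_le_exp hX).2 h
  have h3 := mul_le_mul_of_nonneg_left h2 hX.le
  have h4 := mul_le_mul_of_nonneg_left hb.1 hX.le
  unfold potential
  linarith

theorem sub_potential_zero_le {X y C : ℝ} (hX : 0 < X) (h : X ≤ Real.exp y) :
    C + 2 * X - potential 0 X y ≤ C + X * Real.log X := by
  have hL := Real.log_two_gt_d9
  have h1 := Real.add_one_le_exp (y - Real.log X)
  rw [Real.exp_sub, Real.exp_log hX, le_div_iff₀ hX] at h1
  unfold potential
  rw [supportCoeff_zero]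
  have h2 := mul_le_mul_of_nonneg_right hL.le (Real.exp_pos y).le
  linarith

theorem dyad_sub (j k : ℤ) : (dyad j k).2 - (dyad j k).1 = (2 : ℝ) ^ (-j) := by
  simp only [dyad]; ring

theorem dyad_lt (j k : ℤ) : (dyad j k).1 < (dyad j k).2 := by
  have := dyad_sub j k
  have h : (0 : ℝ) < 2 ^ (-j) := by positivity
  linarith

theorem two_zpow_neg_add_one (j : ℤ) : (2 : ℝ) ^ (-(j + 1)) = 2 ^ (-j) / 2 := by
  rw [neg_add, zpow_add₀ two_ne_zero]; norm_num; ring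

theorem dyad_left_fst (j k : ℤ) : (dyad (j + 1) (2 * k)).1 = (dyad j k).1 := by
  simp only [dyad, two_zpow_neg_add_one]; push_cast; ring

theorem dyad_right_fst (j k : ℤ) :
    (dyad (j + 1) (2 * k + 1)).1 = (dyad (j + 1) (2 * k)).2 := by
  simp only [dyad]; push_cast; ring

theorem dyad_right_snd (j k : ℤ) : (dyad (j + 1) (2 * k + 1)).2 = (dyad j k).2 := by
  simp only [dyad, two_zpow_neg_add_one]; push_cast; ring

/-- The average over the dyadic interval of generation `j` and index `k`. -/
def dyadAvg (f : ℝ → ℝ) (j k : ℤ) : ℝ := avg f (dyad j k).1 (dyad j k).2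

theorem integral_dyad (f : ℝ → ℝ) (j k : ℤ) :
    ∫ x in (dyad j k).1..(dyad j k).2, f x = 2 ^ (-j) * dyadAvg f j k := by
  have h : (0 : ℝ) < 2 ^ (-j) := by positivity
  rw [dyadAvg, avg, dyad_sub, mul_inv_cancel_left₀ h.ne']

theorem MeasureTheory.LocallyIntegrable.intervalIntegrable_real {f : ℝ → ℝ}
    (hf : LocallyIntegrable f volume) (a b : ℝ) : IntervalIntegrable f volume a b :=
  (hf.integrableOn_isCompact isCompact_uIcc).intervalIntegrable

theorem dyadAvg_eq_half {f : ℝ → ℝ} (hf : LocallyIntegrable f volume) (j k : ℤ) :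
    dyadAvg f j k = (dyadAvg f (j + 1) (2 * k) + dyadAvg f (j + 1) (2 * k + 1)) / 2 := by
  have h := intervalIntegral.integral_add_adjacent_intervals
    (hf.intervalIntegrable_real (dyad (j + 1) (2 * k)).1 (dyad (j + 1) (2 * k)).2)
    (hf.intervalIntegrable_real (dyad (j + 1) (2 * k)).2 (dyad (j + 1) (2 * k + 1)).2)
  rw [integral_dyad, ← dyad_right_fst, integral_dyad, dyad_left_fst, dyad_right_snd, integral_dyad,
    two_zpow_neg_add_one] at h
  have h0 : (0 : ℝ) < 2 ^ (-j) := by positivity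
  refine mul_left_cancel₀ h0.ne' ?_
  linarith

theorem dyadAvg_pos {w : ℝ → ℝ} (hw : IsWeight w) (j k : ℤ) : 0 < dyadAvg w j k := by
  have h : 0 < ∫ x in (dyad j k).1..(dyad j k).2, w x := by
    rw [intervalIntegral.integral_pos_iff_support_of_nonneg_ae
      (hw.2.mono fun x hx => hx.le) (hw.1.intervalIntegrable_real _ _)]
    refine ⟨dyad_lt j k, ?_⟩
    have : (Function.support w ∩ Set.Ioc (dyad j k).1 (dyad j k).2 : Set ℝ) =ᵐ[volume]
        Set.Ioc (dyad j k).1 (dyad j k).2 := by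
      filter_upwards [hw.2] with x hx
      have : x ∈ Function.support w := hx.ne'
      exact propext ⟨fun h => h.2, fun h => ⟨this, h⟩⟩
    rw [measure_congr this, Real.volume_Ioc, ENNReal.ofReal_pos, dyad_sub]
    positivity
  rw [integral_dyad] at h
  exact pos_of_mul_pos_right h (by positivity)

theorem exp_dyadAvg_log_le {w : ℝ → ℝ} (hw : IsWeight w)
    (hlog : LocallyIntegrable (fun x => Real.log (w x)) volume) (j k : ℤ) :
    Real.exp (dyadAvg (fun x => Real.log (w x)) j k) ≤ dyadAvg w j k := by
  set Y := dyadAvg (fun x => Real.log (w x)) j k with hY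
  have hfi := hlog.intervalIntegrable_real (dyad j k).1 (dyad j k).2
  have h : ∫ x in (dyad j k).1..(dyad j k).2, Real.exp Y * (Real.log (w x) + (1 - Y)) ≤
      ∫ x in (dyad j k).1..(dyad j k).2, w x := by
    refine intervalIntegral.integral_mono_ae (dyad_lt j k).le
      ((hfi.add intervalIntegrable_const).const_mul _) (hw.1.intervalIntegrable_real _ _) ?_
    filter_upwards [hw.2] with x hx
    have h1 := Real.add_one_le_exp (Real.log (w x) - Y)
    have h2 : Real.exp Y * Real.exp (Real.log (w x) - Y) = w x := by
      rw [← Real.exp_add, add_sub_cancel, Real.exp_log hx]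
    have h3 := mul_le_mul_of_nonneg_left h1 (Real.exp_pos Y).le
    linarith
  rw [intervalIntegral.integral_const_mul,
    intervalIntegral.integral_add hfi intervalIntegrable_const,
    intervalIntegral.integral_const, integral_dyad, integral_dyad, dyad_sub, ← hY] at h
  have h0 : (0 : ℝ) < 2 ^ (-j) := by positivity
  refine le_of_mul_le_mul_left ?_ h0
  rw [smul_eq_mul] at h
  linarith

theorem dyadAvg_mul_exp_neg_le {w : ℝ → ℝ} (hfin : AInfConst w ≠ ⊤) (j k : ℤ) :
    dyadAvg w j k * Real.exp (-dyadAvg (fun x => Real.log (w x)) j k) ≤ (AInfConst w).toReal := by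
  rw [← ENNReal.ofReal_le_iff_le_toReal hfin]
  exact le_iSup₂_of_le j k le_rfl

theorem dyadAvg_le_exp {w : ℝ → ℝ} {Q : ℝ} (hQ0 : 0 < Q) {j k : ℤ}
    (hQ : dyadAvg w j k * Real.exp (-dyadAvg (fun x => Real.log (w x)) j k) ≤ Q) :
    dyadAvg w j k ≤ Real.exp (dyadAvg (fun x => Real.log (w x)) j k + Real.log Q) := by
  rw [Real.exp_add, Real.exp_log hQ0]
  rw [Real.exp_neg, ← div_eq_mul_inv, div_le_iff₀ (Real.exp_pos _)] at hQ
  linarith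

/-- The average of `w` over the dyadic interval of generation `m` containing `x`. -/
def martingaleAvg (w : ℝ → ℝ) (m : ℤ) (x : ℝ) : ℝ := dyadAvg w m ⌊x * 2 ^ m⌋

theorem measurable_martingaleAvg (w : ℝ → ℝ) (m : ℤ) : Measurable (martingaleAvg w m) :=
  (measurable_from_top (f := fun k : ℤ => dyadAvg w m k)).comp
    (Int.measurable_floor.comp (measurable_id.mul_const _))

theorem mem_dyad_iff {j k : ℤ} {x : ℝ} :
    x ∈ Set.Ico (dyad j k).1 (dyad j k).2 ↔ ⌊x * 2 ^ j⌋ = k := by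
  have h : (0 : ℝ) < 2 ^ j := by positivity
  rw [Int.floor_eq_iff, Set.mem_Ico]
  simp only [dyad, zpow_neg, ← div_eq_mul_inv, div_le_iff₀ h, lt_div_iff₀ h]

theorem martingaleAvg_of_mem {w : ℝ → ℝ} {j k : ℤ} {x : ℝ}
    (hx : x ∈ Set.Ico (dyad j k).1 (dyad j k).2) : martingaleAvg w j x = dyadAvg w j k := by
  rw [martingaleAvg, mem_dyad_iff.1 hx]

theorem mul_log_add_one_nonneg {x : ℝ} (hx : 0 ≤ x) : 0 ≤ x * Real.log x + 1 := by
  rcases hx.eq_or_lt with rfl | h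
  · simp
  · have h1 := Real.one_sub_inv_le_log_of_pos h
    have h2 := mul_le_mul_of_nonneg_left h1 hx
    rw [mul_sub, mul_inv_cancel₀ h.ne'] at h2
    linarith

theorem supportCoeff_zero_nonneg : 0 ≤ supportCoeff 0 := supportCoeff_nonneg le_rfl

theorem lintegral_martingaleAvg_le {w : ℝ → ℝ} (hw : IsWeight w)
    (hlog : LocallyIntegrable (fun x => Real.log (w x)) volume) {Q : ℝ} (hQ0 : 0 < Q)
    (hQ : ∀ j k, dyadAvg w j k * Real.exp (-dyadAvg (fun x => Real.log (w x)) j k) ≤ Q)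
    (n : ℕ) (j k : ℤ) {b : ℝ} (hb : b ∈ Set.Icc (-142 / 100 : ℝ) 0) :
    ∫⁻ x in Set.Ico (dyad j k).1 (dyad j k).2, ENNReal.ofReal
        (martingaleAvg w (j + n) x * Real.log (martingaleAvg w (j + n) x) + 1) ≤
      ENNReal.ofReal (2 ^ (-j) * (supportCoeff 0 * Q * dyadAvg w j k + 2 * dyadAvg w j k -
        potential b (dyadAvg w j k) (dyadAvg (fun x => Real.log (w x)) j k + Real.log Q) + 1)) := by
  have hbase : ∀ j k : ℤ, ∀ b ∈ Set.Icc (-142 / 100 : ℝ) 0,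
      dyadAvg w j k * Real.log (dyadAvg w j k) + 1 ≤
      supportCoeff 0 * Q * dyadAvg w j k + 2 * dyadAvg w j k -
        potential b (dyadAvg w j k) (dyadAvg (fun x => Real.log (w x)) j k + Real.log Q) + 1 := by
    intro j k b hb
    have h1 := mul_log_le_sub_potential hb (dyadAvg_pos hw j k) (dyadAvg_le_exp hQ0 (hQ j k))
    rw [Real.exp_add, Real.exp_log hQ0] at h1
    have h2 := mul_le_mul_of_nonneg_left (exp_dyadAvg_log_le hw hlog j k)
      (mul_nonneg supportCoeff_zero_nonneg hQ0.le)
    linarith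
  induction n generalizing j k b with
  | zero =>
    rw [setLIntegral_congr_fun (g := fun _ => ENNReal.ofReal
      (dyadAvg w j k * Real.log (dyadAvg w j k) + 1)) measurableSet_Ico, setLIntegral_const,
      Real.volume_Ico, dyad_sub, mul_comm, ← ENNReal.ofReal_mul (by positivity)]
    · exact ENNReal.ofReal_le_ofReal (mul_le_mul_of_nonneg_left (hbase j k b hb) (by positivity))
    · intro x hx
      simp only [Nat.cast_zero, add_zero, martingaleAvg_of_mem hx]
  | succ n ih =>
    have hsplit : Set.Ico (dyad j k).1 (dyad j k).2 =
        Set.Ico (dyad (j + 1) (2 * k)).1 (dyad (j + 1) (2 * k)).2 ∪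
        Set.Ico (dyad (j + 1) (2 * k + 1)).1 (dyad (j + 1) (2 * k + 1)).2 := by
      rw [dyad_right_fst, Set.Ico_union_Ico_eq_Ico (dyad_lt _ _).le, dyad_left_fst, dyad_right_snd]
      rw [← dyad_right_fst]
      exact (dyad_lt _ _).le
    have hdisj : Disjoint (Set.Ico (dyad (j + 1) (2 * k)).1 (dyad (j + 1) (2 * k)).2)
        (Set.Ico (dyad (j + 1) (2 * k + 1)).1 (dyad (j + 1) (2 * k + 1)).2) := by
      rw [dyad_right_fst]
      exact Set.Ico_disjoint_Ico_same
    have hX := dyadAvg_eq_half hw.1 j k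
    have hY := dyadAvg_eq_half hlog j k
    have hY' : dyadAvg (fun x => Real.log (w x)) j k + Real.log Q =
      (dyadAvg (fun x => Real.log (w x)) (j + 1) (2 * k) + Real.log Q +
        (dyadAvg (fun x => Real.log (w x)) (j + 1) (2 * k + 1) + Real.log Q)) / 2 := by
      rw [hY]; ring
    have hle := dyadAvg_le_exp hQ0 (hQ j k)
    rw [hY', hX] at hle
    obtain ⟨b₁, hb₁, b₂, hb₂, H⟩ := exists_potential_le hb (dyadAvg_pos hw (j + 1) (2 * k)).le
      (dyadAvg_pos hw (j + 1) (2 * k + 1)).le (dyadAvg_le_exp hQ0 (hQ _ _))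
      (dyadAvg_le_exp hQ0 (hQ _ _)) hle
    rw [← hX, ← hY'] at H
    have hm : j + ((n + 1 : ℕ) : ℤ) = j + 1 + n := by push_cast; ring
    have n1 := (mul_log_add_one_nonneg (dyadAvg_pos hw _ _).le).trans
      (hbase (j + 1) (2 * k) b₁ hb₁)
    have n2 := (mul_log_add_one_nonneg (dyadAvg_pos hw _ _).le).trans
      (hbase (j + 1) (2 * k + 1) b₂ hb₂)
    rw [hm, hsplit, lintegral_union measurableSet_Ico hdisj]
    refine (add_le_add (ih (j + 1) (2 * k) hb₁) (ih (j + 1) (2 * k + 1) hb₂)).trans ?_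
    rw [← ENNReal.ofReal_add (mul_nonneg (by positivity) n1) (mul_nonneg (by positivity) n2),
      two_zpow_neg_add_one]
    refine ENNReal.ofReal_le_ofReal ?_
    have h0 : (0 : ℝ) < 2 ^ (-j) := by positivity
    rw [← mul_add, div_mul_eq_mul_div, ← mul_div_assoc']
    refine mul_le_mul_of_nonneg_left ?_ h0.le
    have hQX : supportCoeff 0 * Q * dyadAvg w j k = supportCoeff 0 * Q *
        ((dyadAvg w (j + 1) (2 * k) + dyadAvg w (j + 1) (2 * k + 1)) / 2) := by rw [← hX]
    linarith

theorem ae_tendsto_martingaleAvg {w : ℝ → ℝ} (hw : LocallyIntegrable w volume) (j : ℤ) :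
    ∀ᵐ x, Filter.Tendsto (fun n : ℕ => martingaleAvg w (j + n) x) Filter.atTop (nhds (w x)) := by
  filter_upwards [IsUnifLocDoublingMeasure.ae_tendsto_average (μ := volume) hw 1] with x hx
  set k : ℕ → ℤ := fun n => ⌊x * 2 ^ (j + n : ℤ)⌋ with hk
  set r : ℕ → ℝ := fun n => 2 ^ (-(j + n : ℤ)) / 2 with hr
  set c : ℕ → ℝ := fun n => (dyad (j + n) (k n)).1 + r n with hc
  have hleft : ∀ n, c n - r n = (dyad (j + n) (k n)).1 := fun n => by simp only [hc]; ring
  have hright : ∀ n, c n + r n = (dyad (j + n) (k n)).2 := fun n => by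
    have := dyad_sub (j + n) (k n)
    simp only [hc, hr]; linarith
  have hr0 : ∀ n, 0 < r n := fun n => by simp only [hr]; positivity
  have hrt : Filter.Tendsto r Filter.atTop (nhdsWithin 0 (Set.Ioi 0)) := by
    refine tendsto_nhdsWithin_iff.2 ⟨?_, Filter.Eventually.of_forall hr0⟩
    have h1 : r = fun n => (2 ^ (-j) / 2 : ℝ) * (1 / 2) ^ n := by
      funext n
      simp only [hr, neg_add, zpow_add₀ (two_ne_zero : (2 : ℝ) ≠ 0), zpow_neg, zpow_natCast,
        one_div, inv_pow]
      ring
    rw [h1]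
    simpa using (tendsto_pow_atTop_nhds_zero_of_lt_one (by norm_num : (0 : ℝ) ≤ 1 / 2)
      (by norm_num)).const_mul (2 ^ (-j) / 2 : ℝ)
  have h := hx c r hrt (Filter.Eventually.of_forall fun n => by
    rw [one_mul, Real.closedBall_eq_Icc, hleft, hright]
    exact Set.Ico_subset_Icc_self (mem_dyad_iff.2 rfl))
  refine h.congr fun n => ?_
  rw [Real.closedBall_eq_Icc, hleft, hright, setAverage_eq, integral_Icc_eq_integral_Ioc,
    ← intervalIntegral.integral_of_le (dyad_lt _ _).le, smul_eq_mul, martingaleAvg, dyadAvg, avg,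
    Real.volume_real_Icc_of_le (dyad_lt _ _).le]

theorem lintegral_mul_log_le {w : ℝ → ℝ} (hw : IsWeight w)
    (hlog : LocallyIntegrable (fun x => Real.log (w x)) volume) {Q : ℝ} (hQ0 : 0 < Q)
    (hQ : ∀ j k, dyadAvg w j k * Real.exp (-dyadAvg (fun x => Real.log (w x)) j k) ≤ Q)
    (j k : ℤ) :
    ∫⁻ x in Set.Ico (dyad j k).1 (dyad j k).2, ENNReal.ofReal (w x * Real.log (w x) + 1) ≤
      ENNReal.ofReal (2 ^ (-j) * (supportCoeff 0 * Q * dyadAvg w j k +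
        dyadAvg w j k * Real.log (dyadAvg w j k) + 1)) := by
  have hcont : Continuous fun v : ℝ => ENNReal.ofReal (v * Real.log v + 1) :=
    ENNReal.continuous_ofReal.comp (Real.continuous_mul_log.add continuous_const)
  have hlim : ∀ᵐ x, ENNReal.ofReal (w x * Real.log (w x) + 1) =
      Filter.liminf (fun n : ℕ => ENNReal.ofReal
        (martingaleAvg w (j + n) x * Real.log (martingaleAvg w (j + n) x) + 1)) Filter.atTop := by
    filter_upwards [ae_tendsto_martingaleAvg hw.1 j] with x hx
    exact ((hcont.tendsto _).comp hx).liminf_eq.symm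
  rw [lintegral_congr_ae (ae_restrict_of_ae hlim)]
  refine (lintegral_liminf_le (u := Filter.atTop) fun n : ℕ =>
    hcont.measurable.comp (measurable_martingaleAvg w (j + n))).trans ?_
  refine Filter.liminf_le_of_le (by isBoundedDefault) fun c hc => ?_
  obtain ⟨n, hn⟩ := hc.exists
  refine (hn.trans (lintegral_martingaleAvg_le hw hlog hQ0 hQ n j k
    (b := 0) ⟨by norm_num, le_rfl⟩)).trans (ENNReal.ofReal_le_ofReal ?_)
  have := sub_potential_zero_le (C := supportCoeff 0 * Q * dyadAvg w j k) (dyadAvg_pos hw j k)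
    (dyadAvg_le_exp hQ0 (hQ j k))
  exact mul_le_mul_of_nonneg_left (by linarith) (by positivity)

theorem dyadAvg_div_mul_log_div_le {w : ℝ → ℝ} (hw : IsWeight w)
    (hlog : LocallyIntegrable (fun x => Real.log (w x)) volume) {Q : ℝ} (hQ0 : 0 < Q)
    (hQ : ∀ j k, dyadAvg w j k * Real.exp (-dyadAvg (fun x => Real.log (w x)) j k) ≤ Q)
    (j k : ℤ) :
    dyadAvg (fun x => w x / dyadAvg w j k * Real.log (w x / dyadAvg w j k)) j k ≤
      supportCoeff 0 * Q := by
  set X := dyadAvg w j k with hX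
  have hX0 : 0 < X := dyadAvg_pos hw j k
  have h0 : (0 : ℝ) < 2 ^ (-j) := by positivity
  have hle := lintegral_mul_log_le hw hlog hQ0 hQ j k
  rw [restrict_Ico_eq_restrict_Ioc, ← hX] at hle
  have hnn : 0 ≤ᵐ[volume.restrict (Set.Ioc (dyad j k).1 (dyad j k).2)]
      fun x => w x * Real.log (w x) + 1 :=
    ae_restrict_of_ae (hw.2.mono fun x hx => mul_log_add_one_nonneg hx.le)
  have hmeas : AEStronglyMeasurable (fun x => w x * Real.log (w x) + 1)
      (volume.restrict (Set.Ioc (dyad j k).1 (dyad j k).2)) :=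
    ((hw.1.aestronglyMeasurable.mul hlog.aestronglyMeasurable).add
      aestronglyMeasurable_const).restrict
  have hfi : IntervalIntegrable (fun x => w x * Real.log (w x) + 1) volume
      (dyad j k).1 (dyad j k).2 :=
    (intervalIntegrable_iff_integrableOn_Ioc_of_le (dyad_lt j k).le).2
      ⟨hmeas, (hasFiniteIntegral_iff_ofReal hnn).2 (hle.trans_lt ENNReal.ofReal_lt_top)⟩
  have hbound : ∫ x in (dyad j k).1..(dyad j k).2, (w x * Real.log (w x) + 1) ≤
      2 ^ (-j) * (supportCoeff 0 * Q * X + X * Real.log X + 1) := by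
    rw [intervalIntegral.integral_of_le (dyad_lt j k).le,
      integral_eq_lintegral_of_nonneg_ae hnn hmeas]
    refine ENNReal.toReal_le_of_le_ofReal ?_ hle
    have h1 := mul_log_add_one_nonneg hX0.le
    have h2 := mul_nonneg (mul_nonneg supportCoeff_zero_nonneg hQ0.le) hX0.le
    exact mul_nonneg h0.le (by linarith)
  have hwint := hw.1.intervalIntegrable_real (dyad j k).1 (dyad j k).2
  have hcongr : ∫ x in (dyad j k).1..(dyad j k).2, w x / X * Real.log (w x / X) =
      ∫ x in (dyad j k).1..(dyad j k).2,
        (X⁻¹ * (w x * Real.log (w x) + 1) - X⁻¹ * Real.log X * w x - X⁻¹) := by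
    refine intervalIntegral.integral_congr_ae (hw.2.mono fun x hx _ => ?_)
    rw [Real.log_div hx.ne' hX0.ne']
    ring
  rw [intervalIntegral.integral_sub ((hfi.const_mul _).sub (hwint.const_mul _))
    intervalIntegrable_const, intervalIntegral.integral_sub (hfi.const_mul _) (hwint.const_mul _),
    intervalIntegral.integral_const_mul, intervalIntegral.integral_const_mul,
    intervalIntegral.integral_const, dyad_sub, smul_eq_mul, integral_dyad w, ← hX,
    integral_dyad] at hcongr
  refine le_of_mul_le_mul_left ?_ h0
  rw [hcongr]
  have h1 := mul_le_mul_of_nonneg_left hbound (inv_pos.2 hX0).le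
  have h2 : X⁻¹ * X = 1 := inv_mul_cancel₀ hX0.ne'
  calc _ ≤ X⁻¹ * (2 ^ (-j) * (supportCoeff 0 * Q * X + X * Real.log X + 1)) -
        X⁻¹ * Real.log X * (2 ^ (-j) * X) - 2 ^ (-j) * X⁻¹ := by linarith
    _ = 2 ^ (-j) * (supportCoeff 0 * Q) * (X⁻¹ * X) := by ring
    _ = _ := by rw [h2, mul_one]

theorem supportCoeff_zero_eq_log : supportCoeff 0 = Real.log 16 := by
  rw [supportCoeff_zero, show (16 : ℝ) = 2 ^ 4 by norm_num, Real.log_pow]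
  norm_num

/-- If the dyadic `A_∞` constant of a weight `w` is finite, then `w ∈ RH_1^d`
and `[w]_{RH_1^d} ≤ log 16 · [w]_{A_∞^d}`. -/
theorem rh1_le_log16_mul_aInf (w : ℝ → ℝ) (hw : IsWeight w)
    (hlog : LocallyIntegrable (fun x => Real.log (w x)) volume)
    (hfin : AInfConst w ≠ ⊤) :
    RH1Const w ≠ ⊤ ∧ RH1Const w ≤ ENNReal.ofReal (Real.log 16) * AInfConst w := by
  have hQ := dyadAvg_mul_exp_neg_le hfin
  have hQ0 : 0 < (AInfConst w).toReal :=
    (mul_pos (dyadAvg_pos hw 0 0) (Real.exp_pos _)).trans_le (hQ 0 0)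
  have h : RH1Const w ≤ ENNReal.ofReal (Real.log 16) * AInfConst w := by
    refine iSup₂_le fun j k => ?_
    refine (ENNReal.ofReal_le_ofReal (dyadAvg_div_mul_log_div_le hw hlog hQ0 hQ j k)).trans ?_
    rw [ENNReal.ofReal_mul supportCoeff_zero_nonneg, ENNReal.ofReal_toReal hfin,
      supportCoeff_zero_eq_log]
  exact ⟨ne_top_of_le_ne_top (ENNReal.mul_ne_top ENNReal.ofReal_ne_top hfin) h, h⟩
end
end

section
/- Let A be a convex twice differentiable function on (0,∞) whose second derivative satisfies ∫_{−1}^{1} (1 − |t|) A''(x + εt) dt ≥ q A''(x) for all x ∈ (0,∞) and all ε with 0 ≤ ε < x, where q > 0 is a constant independent of x and ε. Then for every weight w and every interval J ⊂ ℝ with ⟨A(w)⟩_J finite, (1/|J|) Σ_{I ∈ 𝒟(J)} (Δ_I w)² A''(⟨w⟩_I) |I| ≤ (8/q) ( ⟨A(w)⟩_J − A(⟨w⟩_J) ). -/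
open MeasureTheory Real
open scoped ENNReal

noncomputable section

lemma nonneg_of_convexOn_Ioi_of_hasDerivAt {A A' A'' : ℝ → ℝ}
    (hconv : ConvexOn ℝ (Set.Ioi (0 : ℝ)) A)
    (hA' : ∀ x ∈ Set.Ioi (0 : ℝ), HasDerivAt A (A' x) x)
    (hA'' : ∀ x ∈ Set.Ioi (0 : ℝ), HasDerivAt A' (A'' x) x) {x : ℝ} (hx : 0 < x) :
    0 ≤ A'' x := by
  have hmono : MonotoneOn A' (Set.Ioi 0) :=
    (hconv.monotoneOn_deriv fun y hy => (hA' y hy).differentiableAt).congr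
      fun y hy => (hA' y hy).deriv
  have h := hmono.derivWithin_nonneg (x := x)
  rwa [((hA'' x hx).hasDerivWithinAt).derivWithin (isOpen_Ioi.uniqueDiffWithinAt hx)] at h

/-- A convex function on `(0, ∞)` lies above its tangent lines. -/
lemma tangent_le_of_convexOn_Ioi {A : ℝ → ℝ} {m x y : ℝ}
    (hconv : ConvexOn ℝ (Set.Ioi (0 : ℝ)) A) (hx : 0 < x) (hA : HasDerivAt A m x) (hy : 0 < y) :
    A x + m * (y - x) ≤ A y := by
  rcases lt_trichotomy x y with h | rfl | h
  · have := hconv.le_slope_of_hasDerivAt hx hy h hA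
    rw [slope_def_field, le_div_iff₀ (by linarith)] at this
    linarith
  · simp
  · have := hconv.slope_le_of_hasDerivAt hy hx h hA
    rw [slope_def_field, div_le_iff₀ (by linarith)] at this
    linarith

/-- Second-order Taylor formula for the symmetric second difference, when `A''` is nonnegative. -/
lemma sq_mul_integral_tent_eq {A A' A'' : ℝ → ℝ} {x ε : ℝ}
    (hA' : ∀ y ∈ Set.Ioi (0 : ℝ), HasDerivAt A (A' y) y)
    (hA'' : ∀ y ∈ Set.Ioi (0 : ℝ), HasDerivAt A' (A'' y) y)
    (hnonneg : ∀ y ∈ Set.Ioi (0 : ℝ), 0 ≤ A'' y) (hε : 0 ≤ ε) (hεx : ε < x) :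
    ε ^ 2 * ∫ t in (-1 : ℝ)..1, (1 - |t|) * A'' (x + ε * t) =
      A (x + ε) + A (x - ε) - 2 * A x := by
  have hpos : ∀ t ∈ Set.Icc (-1 : ℝ) 1, 0 < x + ε * t := fun t ht => by nlinarith [ht.1]
  have haff : ∀ t : ℝ, HasDerivAt (fun t => x + ε * t) ε t := fun t => by
    simpa using ((hasDerivAt_id t).const_mul ε).const_add x
  have hd1 : ∀ t ∈ Set.Icc (-1 : ℝ) 1, HasDerivAt (fun t => A (x + ε * t))
      (A' (x + ε * t) * ε) t := fun t ht => (hA' _ (hpos t ht)).comp t (haff t)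
  have hd2 : ∀ t ∈ Set.Icc (-1 : ℝ) 1, HasDerivAt (fun t => A' (x + ε * t))
      (A'' (x + ε * t) * ε) t := fun t ht => (hA'' _ (hpos t ht)).comp t (haff t)
  -- antiderivatives on `[0, 1]` (`s = 1`) and on `[-1, 0]` (`s = -1`)
  have hd : ∀ s : ℝ, s ^ 2 = 1 → ∀ t ∈ Set.Icc (-1 : ℝ) 1,
      HasDerivAt (fun t => ε * (A' (x + ε * t) * (1 - s * t)) + s * A (x + ε * t))
        (ε ^ 2 * ((1 - s * t) * A'' (x + ε * t))) t := fun s hs t ht => by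
    have h1 : HasDerivAt (fun t : ℝ => 1 - s * t) (-s) t := by
      simpa using ((hasDerivAt_id t).const_mul s).const_sub 1
    convert! (((hd2 t ht).mul h1).const_mul ε).add ((hd1 t ht).const_mul s) using 1
    ring
  have key : ∀ s : ℝ, s ^ 2 = 1 → ∀ u v : ℝ, u ≤ v → Set.Icc u v ⊆ Set.Icc (-1 : ℝ) 1 →
      (∀ t ∈ Set.Icc u v, s * t = |t|) →
      IntervalIntegrable (fun t => ε ^ 2 * ((1 - |t|) * A'' (x + ε * t))) volume u v ∧
      ∫ t in u..v, ε ^ 2 * ((1 - |t|) * A'' (x + ε * t)) =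
        (ε * (A' (x + ε * v) * (1 - s * v)) + s * A (x + ε * v)) -
        (ε * (A' (x + ε * u) * (1 - s * u)) + s * A (x + ε * u)) := by
    intro s hs u v huv hsub habs
    have hderiv : ∀ t ∈ Set.Icc u v,
        HasDerivAt (fun t => ε * (A' (x + ε * t) * (1 - s * t)) + s * A (x + ε * t))
          (ε ^ 2 * ((1 - |t|) * A'' (x + ε * t))) t := fun t ht => by
      rw [← habs t ht]
      exact hd s hs t (hsub ht)
    have hi : IntervalIntegrable (fun t => ε ^ 2 * ((1 - |t|) * A'' (x + ε * t))) volume u v := by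
      apply intervalIntegral.intervalIntegrable_deriv_of_nonneg
        (g := fun t => ε * (A' (x + ε * t) * (1 - s * t)) + s * A (x + ε * t))
      · rw [Set.uIcc_of_le huv]
        exact fun t ht => (hderiv t ht).continuousAt.continuousWithinAt
      · rw [min_eq_left huv, max_eq_right huv]
        exact fun t ht => hderiv t (Set.Ioo_subset_Icc_self ht)
      · rw [min_eq_left huv, max_eq_right huv]
        intro t ht
        have ht' := hsub (Set.Ioo_subset_Icc_self ht)
        have h1 : 0 ≤ 1 - |t| := sub_nonneg.2 (abs_le.2 ht')
        have h2 := hnonneg _ (hpos t ht')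
        positivity
    refine ⟨hi, intervalIntegral.integral_eq_sub_of_hasDerivAt (f := fun t =>
      ε * (A' (x + ε * t) * (1 - s * t)) + s * A (x + ε * t)) ?_ hi⟩
    rwa [Set.uIcc_of_le huv]
  obtain ⟨hi1, he1⟩ := key (-1) (by norm_num) (-1) 0 (by norm_num)
    (Set.Icc_subset_Icc le_rfl (by norm_num)) fun t ht => by rw [abs_of_nonpos ht.2]; ring
  obtain ⟨hi2, he2⟩ := key 1 (by norm_num) 0 1 (by norm_num)
    (Set.Icc_subset_Icc (by norm_num) le_rfl) fun t ht => by rw [abs_of_nonneg ht.1]; ring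
  rw [← intervalIntegral.integral_const_mul,
    ← intervalIntegral.integral_add_adjacent_intervals hi1 hi2, he1, he2]
  simp only [mul_neg, mul_one, mul_zero, add_zero, ← sub_eq_add_neg]
  ring

namespace IsWeight

lemma intervalIntegrable {w : ℝ → ℝ} (hw : IsWeight w) (a b : ℝ) :
    IntervalIntegrable w volume a b :=
  (hw.1.integrableOn_isCompact isCompact_uIcc).intervalIntegrable

lemma avg_pos {w : ℝ → ℝ} (hw : IsWeight w) {a b : ℝ} (hab : a < b) : 0 < avg w a b := by
  refine mul_pos (inv_pos.2 (sub_pos.2 hab)) ?_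
  rw [intervalIntegral.integral_pos_iff_support_of_nonneg_ae (hw.2.mono fun x hx => hx.le)
    (hw.intervalIntegrable a b)]
  refine ⟨hab, ?_⟩
  have h : (Function.support w ∩ Set.Ioc a b : Set ℝ) =ᵐ[volume] Set.Ioc a b := by
    filter_upwards [hw.2] with x hx
    exact propext (and_iff_right hx.ne')
  rw [measure_congr h]
  simpa using hab

lemma avg_eq_half_add {w : ℝ → ℝ} (hw : IsWeight w) {a b : ℝ} (hab : a < b) :
    avg w a b = (avg w a (mid a b) + avg w (mid a b) b) / 2 := by
  have h := intervalIntegral.integral_add_adjacent_intervals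
    (hw.intervalIntegrable a (mid a b)) (hw.intervalIntegrable (mid a b) b)
  have h0 : b - a ≠ 0 := (sub_pos.2 hab).ne'
  have h1 : mid a b - a = (b - a) / 2 := by unfold mid; ring
  have h2 : b - mid a b = (b - a) / 2 := by unfold mid; ring
  unfold avg
  rw [← h, h1, h2]
  field_simp

/-- Jensen's inequality for a weight. -/
lemma mul_map_avg_le_integral {w A A' : ℝ → ℝ} (hw : IsWeight w)
    (hconv : ConvexOn ℝ (Set.Ioi (0 : ℝ)) A)
    (hA' : ∀ x ∈ Set.Ioi (0 : ℝ), HasDerivAt A (A' x) x) {a b : ℝ} (hab : a < b)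
    (hint : IntervalIntegrable (fun x => A (w x)) volume a b) :
    A (avg w a b) * (b - a) ≤ ∫ x in a..b, A (w x) := by
  have hpos := hw.avg_pos hab
  have hwi := hw.intervalIntegrable a b
  have hsub : IntervalIntegrable (fun x => A' (avg w a b) * (w x - avg w a b)) volume a b :=
    (hwi.sub intervalIntegrable_const).const_mul _
  have h := intervalIntegral.integral_mono_ae hab.le (intervalIntegrable_const.add hsub) hint
    (hw.2.mono fun x hx => tangent_le_of_convexOn_Ioi hconv hpos (hA' _ hpos) hx)
  have havg : avg w a b * (b - a) = ∫ x in a..b, w x := by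
    unfold avg
    field_simp [(sub_pos.2 hab).ne']
  rw [intervalIntegral.integral_add intervalIntegrable_const hsub,
    intervalIntegral.integral_const_mul, intervalIntegral.integral_sub hwi intervalIntegrable_const,
    ← havg] at h
  simp only [intervalIntegral.integral_const, smul_eq_mul] at h
  linarith

/-- One step of the Bellman induction. -/
lemma delta_sq_mul_le {w A A' A'' : ℝ → ℝ} {q : ℝ} (hq : 0 < q) (hw : IsWeight w)
    (hA' : ∀ x ∈ Set.Ioi (0 : ℝ), HasDerivAt A (A' x) x)
    (hA'' : ∀ x ∈ Set.Ioi (0 : ℝ), HasDerivAt A' (A'' x) x)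
    (hnonneg : ∀ x ∈ Set.Ioi (0 : ℝ), 0 ≤ A'' x)
    (hineq : ∀ x ∈ Set.Ioi (0 : ℝ), ∀ ε : ℝ, 0 ≤ ε → ε < x →
      q * A'' x ≤ ∫ t in (-1 : ℝ)..1, (1 - |t|) * A'' (x + ε * t)) {a b : ℝ} (hab : a < b) :
    delta w a b ^ 2 * A'' (avg w a b) ≤
      8 / q * ((A (avg w a (mid a b)) + A (avg w (mid a b) b)) / 2 - A (avg w a b)) := by
  have hx := hw.avg_pos hab
  have h1 : 0 < avg w a (mid a b) := hw.avg_pos (by unfold mid; linarith)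
  have h2 : 0 < avg w (mid a b) b := hw.avg_pos (by unfold mid; linarith)
  have havg := hw.avg_eq_half_add hab
  have hε : |delta w a b / 2| < avg w a b := by
    rw [abs_lt, havg]
    unfold delta
    constructor <;> linarith
  have hT := sq_mul_integral_tent_eq hA' hA'' hnonneg (abs_nonneg (delta w a b / 2)) hε
  have hI := mul_le_mul_of_nonneg_left (hineq _ hx _ (abs_nonneg _) hε)
    (sq_nonneg |delta w a b / 2|)
  have hsymm : A (avg w a b + |delta w a b / 2|) + A (avg w a b - |delta w a b / 2|) =
      A (avg w a (mid a b)) + A (avg w (mid a b) b) := by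
    have e1 : avg w a b + delta w a b / 2 = avg w a (mid a b) := by
      rw [havg]; unfold delta; ring
    have e2 : avg w a b - delta w a b / 2 = avg w (mid a b) b := by
      rw [havg]; unfold delta; ring
    rcases abs_choice (delta w a b / 2) with h | h <;> rw [h]
    · rw [e1, e2]
    · rw [← sub_eq_add_neg, sub_neg_eq_add, e1, e2, add_comm]
  rw [hT, hsymm, sq_abs] at hI
  rw [div_mul_eq_mul_div, le_div_iff₀ hq]
  linarith

end IsWeight

lemma sum_range_two_mul (f : ℕ → ℝ) (m : ℕ) :
    ∑ k ∈ Finset.range (2 * m), f k = ∑ k ∈ Finset.range m, (f (2 * k) + f (2 * k + 1)) := by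
  induction m with
  | zero => simp
  | succ m ih =>
    rw [Nat.mul_succ, Finset.sum_range_succ, Finset.sum_range_succ, ih, Finset.sum_range_succ]
    ring

lemma subInt_fst_lt_snd {a b : ℝ} (hab : a < b) (n k : ℕ) :
    (subInt a b n k).1 < (subInt a b n k).2 := by
  have : 0 < (b - a) / 2 ^ n := div_pos (sub_pos.2 hab) (by positivity)
  simp only [subInt]
  linarith

lemma subInt_succ_two_mul (a b : ℝ) (n k : ℕ) :
    subInt a b (n + 1) (2 * k) =
      ((subInt a b n k).1, mid (subInt a b n k).1 (subInt a b n k).2) := by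
  simp only [subInt, mid, Prod.mk.injEq]
  push_cast
  constructor <;> field_simp <;> ring

lemma subInt_succ_two_mul_add_one (a b : ℝ) (n k : ℕ) :
    subInt a b (n + 1) (2 * k + 1) =
      (mid (subInt a b n k).1 (subInt a b n k).2, (subInt a b n k).2) := by
  simp only [subInt, mid, Prod.mk.injEq]
  push_cast
  constructor <;> field_simp <;> ring

/-- `Σ_I A(⟨w⟩_I) |I|` over the `n`-th bisection generation of `[a, b]`. -/
def levelSum (A w : ℝ → ℝ) (a b : ℝ) (n : ℕ) : ℝ :=
  ∑ k ∈ Finset.range (2 ^ n),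
    A (avg w (subInt a b n k).1 (subInt a b n k).2) * ((b - a) / 2 ^ n)

lemma levelSum_zero (A w : ℝ → ℝ) (a b : ℝ) :
    levelSum A w a b 0 = A (avg w a b) * (b - a) := by
  simp [levelSum, subInt]

lemma levelSum_succ (A w : ℝ → ℝ) (a b : ℝ) (n : ℕ) :
    levelSum A w a b (n + 1) = ∑ k ∈ Finset.range (2 ^ n),
      (A (avg w (subInt a b n k).1 (mid (subInt a b n k).1 (subInt a b n k).2)) +
        A (avg w (mid (subInt a b n k).1 (subInt a b n k).2) (subInt a b n k).2)) / 2 *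
          ((b - a) / 2 ^ n) := by
  rw [levelSum, pow_succ', sum_range_two_mul]
  refine Finset.sum_congr rfl fun k _ => ?_
  rw [subInt_succ_two_mul, subInt_succ_two_mul_add_one, pow_succ]
  field_simp

lemma levelSum_le_integral {w A A' : ℝ → ℝ} (hw : IsWeight w)
    (hconv : ConvexOn ℝ (Set.Ioi (0 : ℝ)) A)
    (hA' : ∀ x ∈ Set.Ioi (0 : ℝ), HasDerivAt A (A' x) x) {a b : ℝ} (hab : a < b)
    (hint : IntervalIntegrable (fun x => A (w x)) volume a b) (n : ℕ) :
    levelSum A w a b n ≤ ∫ x in a..b, A (w x) := by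
  have hlen : 0 < (b - a) / 2 ^ n := div_pos (sub_pos.2 hab) (by positivity)
  set p : ℕ → ℝ := fun k => a + k * ((b - a) / 2 ^ n) with hp
  have hp0 : p 0 = a := by simp [hp]
  have hpn : p (2 ^ n) = b := by
    simp only [hp]
    push_cast
    field_simp
    ring
  have hmono : Monotone p := fun i j hij => by
    have : (i : ℝ) ≤ j := by exact_mod_cast hij
    simp only [hp]
    gcongr
  have hsub : ∀ k, subInt a b n k = (p k, p (k + 1)) := fun k => by simp [subInt, hp]
  have hi : ∀ k < 2 ^ n, IntervalIntegrable (fun x => A (w x)) volume (p k) (p (k + 1)) := by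
    intro k hk
    refine hint.mono_set ?_
    rw [Set.uIcc_of_le (hmono k.le_succ), Set.uIcc_of_le hab.le]
    exact Set.Icc_subset_Icc (hp0 ▸ hmono k.zero_le) (hpn ▸ hmono hk)
  have h := intervalIntegral.sum_integral_adjacent_intervals hi
  rw [hp0, hpn] at h
  rw [← h]
  refine Finset.sum_le_sum fun k hk => ?_
  have hlt := subInt_fst_lt_snd hab n k
  have hJ := hw.mul_map_avg_le_integral hconv hA' (a := p k) (b := p (k + 1))
    (by simpa [hsub] using hlt) (hi k (Finset.mem_range.1 hk))
  have hlen' : p (k + 1) - p k = (b - a) / 2 ^ n := by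
    simp only [hp]
    push_cast
    ring
  rw [hsub]
  rwa [hlen'] at hJ

/-- Lemma II.2, second part, with constant `8/q`. -/
theorem bellmanSum_le_of_integral_condition
    (A A' A'' : ℝ → ℝ) (q : ℝ) (hq : 0 < q)
    (hconv : ConvexOn ℝ (Set.Ioi (0 : ℝ)) A)
    (hA' : ∀ x ∈ Set.Ioi (0 : ℝ), HasDerivAt A (A' x) x)
    (hA'' : ∀ x ∈ Set.Ioi (0 : ℝ), HasDerivAt A' (A'' x) x)
    (hineq : ∀ x ∈ Set.Ioi (0 : ℝ), ∀ ε : ℝ, 0 ≤ ε → ε < x →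
      q * A'' x ≤ ∫ t in (-1 : ℝ)..1, (1 - |t|) * A'' (x + ε * t))
    (w : ℝ → ℝ) (hw : IsWeight w) (a b : ℝ) (hab : a < b)
    (hint : IntervalIntegrable (fun x => A (w x)) volume a b) :
    bellmanSum w a b A'' ≤ (8 / q) * (avg (fun x => A (w x)) a b - A (avg w a b)) := by
  have hnonneg : ∀ x ∈ Set.Ioi (0 : ℝ), 0 ≤ A'' x := fun x hx =>
    nonneg_of_convexOn_Ioi_of_hasDerivAt hconv hA' hA'' hx
  have hba : 0 < b - a := sub_pos.2 hab
  have hstep : ∀ n : ℕ, ∑ k ∈ Finset.range (2 ^ n),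
      delta w (subInt a b n k).1 (subInt a b n k).2 ^ 2 *
        A'' (avg w (subInt a b n k).1 (subInt a b n k).2) * ((b - a) / 2 ^ n) ≤
      8 / q * (levelSum A w a b (n + 1) - levelSum A w a b n) := by
    intro n
    rw [levelSum_succ, levelSum, ← Finset.sum_sub_distrib, Finset.mul_sum]
    refine Finset.sum_le_sum fun k _ => ?_
    rw [← sub_mul, ← mul_assoc]
    exact mul_le_mul_of_nonneg_right
      (hw.delta_sq_mul_le hq hA' hA'' hnonneg hineq (subInt_fst_lt_snd hab n k)) (by positivity)
  have htsum : ∑' n : ℕ, ∑ k ∈ Finset.range (2 ^ n),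
      delta w (subInt a b n k).1 (subInt a b n k).2 ^ 2 *
        A'' (avg w (subInt a b n k).1 (subInt a b n k).2) * ((b - a) / 2 ^ n) ≤
      8 / q * ((∫ x in a..b, A (w x)) - A (avg w a b) * (b - a)) := by
    refine Real.tsum_le_of_sum_range_le (fun n => Finset.sum_nonneg fun k _ => ?_) fun N => ?_
    · have := hnonneg _ (hw.avg_pos (subInt_fst_lt_snd hab n k))
      positivity
    · refine (Finset.sum_le_sum fun n _ => hstep n).trans ?_
      rw [← Finset.mul_sum, Finset.sum_range_sub, levelSum_zero]
      gcongr
      exact levelSum_le_integral hw hconv hA' hab hint N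
  refine (mul_le_mul_of_nonneg_left htsum (inv_nonneg.2 hba.le)).trans_eq ?_
  unfold avg
  field_simp
end
end

section
/- Let 1 < p < ∞. There exist positive real constants c and C, independent of the weight, such that for every weight w and every interval J ⊂ ℝ with ⟨w^p⟩_J finite: c ( ⟨w^p⟩_J − ⟨w⟩_J^p ) ≤ (1/|J|) Σ_{I ∈ 𝒟(J)} (Δ_I w / ⟨w⟩_I)² ⟨w⟩_I^p |I| ≤ C ( ⟨w^p⟩_J − ⟨w⟩_J^p ). -/
open MeasureTheory Real
open scoped ENNReal

noncomputable section

lemma mul_le_rpow_one_add_sub_rpow_one_sub {q s : ℝ} (hq : 0 < q) (hs0 : 0 ≤ s) (hs1 : s ≤ 1) :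
    q * s ≤ (1 + s) ^ q - (1 - s) ^ q := by
  rcases le_total 1 q with h | h
  · have h1 := one_add_mul_self_le_rpow_one_add (s := s) (by linarith) h
    have h2 : (1 - s) ^ q ≤ 1 := rpow_le_one (by linarith) (by linarith) hq.le
    linarith
  · have h1 := rpow_one_add_le_one_add_mul_self (s := -s) (by linarith) hq.le h
    have h2 : 1 ≤ (1 + s) ^ q := one_le_rpow (by linarith) hq.le
    rw [← sub_eq_add_neg] at h1
    linarith

lemma rpow_one_add_sub_rpow_one_sub_le {q s : ℝ} (hq : 0 < q) (hs0 : 0 ≤ s) (hs1 : s ≤ 1) :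
    (1 + s) ^ q - (1 - s) ^ q ≤ ((2 : ℝ) ^ q + q + 1) * s := by
  have h3 : 0 < (2 : ℝ) ^ q := by positivity
  rcases le_total 1 q with h | h
  · have h1 := one_add_mul_self_le_rpow_one_add (s := -s) (by linarith) h
    have h2 := (convexOn_rpow h).2 (show (1 : ℝ) ∈ Set.Ici 0 by simp)
      (show (2 : ℝ) ∈ Set.Ici 0 by simp) (sub_nonneg.2 hs1) hs0 (by ring)
    simp only [smul_eq_mul, one_rpow, mul_one] at h2
    rw [show 1 - s + s * 2 = 1 + s by ring] at h2
    rw [← sub_eq_add_neg] at h1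
    nlinarith
  · have h1 := rpow_one_add_le_one_add_mul_self (s := s) (by linarith) hq.le h
    have h2 : 1 - s ≤ (1 - s) ^ q := by
      simpa using rpow_le_rpow_of_exponent_ge_of_imp (x := 1 - s) (by linarith) (by linarith)
        h (by intro _ h0; norm_num at h0)
    nlinarith

lemma hasDerivAt_rpow_one_add_add_rpow_one_sub {p : ℝ} (hp : 1 ≤ p) (s : ℝ) :
    HasDerivAt (fun s : ℝ => (1 + s) ^ p + (1 - s) ^ p)
      (p * ((1 + s) ^ (p - 1) - (1 - s) ^ (p - 1))) s := by
  have h1 := ((hasDerivAt_id s).const_add 1).rpow_const (p := p) (Or.inr hp)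
  have h2 := ((hasDerivAt_id s).const_sub 1).rpow_const (p := p) (Or.inr hp)
  refine (h1.fun_add h2).congr_deriv ?_
  simp only [id]
  ring

lemma le_rpow_one_add_add_rpow_one_sub {p s : ℝ} (hp : 1 < p) (hs0 : 0 ≤ s) (hs1 : s ≤ 1) :
    p * (p - 1) / 2 * s ^ 2 ≤ (1 + s) ^ p + (1 - s) ^ p - 2 := by
  have hd (t : ℝ) : HasDerivAt
      (fun s : ℝ => (1 + s) ^ p + (1 - s) ^ p - p * (p - 1) / 2 * s ^ 2)
      (p * ((1 + t) ^ (p - 1) - (1 - t) ^ (p - 1)) - p * (p - 1) * t) t := by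
    refine ((hasDerivAt_rpow_one_add_add_rpow_one_sub hp.le t).fun_sub
      ((hasDerivAt_pow 2 t).const_mul (p * (p - 1) / 2))).congr_deriv ?_
    push_cast; ring
  have hmono := monotoneOn_of_deriv_nonneg (convex_Icc (0 : ℝ) 1)
    (fun t _ => (hd t).continuousAt.continuousWithinAt)
    (fun t _ => (hd t).differentiableAt.differentiableWithinAt)
    (fun t ht => by
      rw [interior_Icc] at ht
      rw [(hd t).deriv]
      have := mul_le_rpow_one_add_sub_rpow_one_sub (q := p - 1) (by linarith) ht.1.le ht.2.le
      nlinarith)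
  have h := hmono (Set.left_mem_Icc.2 zero_le_one) ⟨hs0, hs1⟩ hs0
  norm_num at h
  linarith

lemma rpow_one_add_add_rpow_one_sub_le {p s : ℝ} (hp : 1 < p) (hs0 : 0 ≤ s) (hs1 : s ≤ 1) :
    (1 + s) ^ p + (1 - s) ^ p - 2 ≤ p * ((2 : ℝ) ^ (p - 1) + p) / 2 * s ^ 2 := by
  have hd (t : ℝ) : HasDerivAt
      (fun s : ℝ => p * ((2 : ℝ) ^ (p - 1) + p) / 2 * s ^ 2 - ((1 + s) ^ p + (1 - s) ^ p))
      (p * ((2 : ℝ) ^ (p - 1) + p) * t - p * ((1 + t) ^ (p - 1) - (1 - t) ^ (p - 1))) t := by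
    refine (((hasDerivAt_pow 2 t).const_mul (p * ((2 : ℝ) ^ (p - 1) + p) / 2)).fun_sub
      (hasDerivAt_rpow_one_add_add_rpow_one_sub hp.le t)).congr_deriv ?_
    push_cast; ring
  have hmono := monotoneOn_of_deriv_nonneg (convex_Icc (0 : ℝ) 1)
    (fun t _ => (hd t).continuousAt.continuousWithinAt)
    (fun t _ => (hd t).differentiableAt.differentiableWithinAt)
    (fun t ht => by
      rw [interior_Icc] at ht
      rw [(hd t).deriv]
      have := rpow_one_add_sub_rpow_one_sub_le (q := p - 1) (by linarith) ht.1.le ht.2.le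
      nlinarith)
  have h := hmono (Set.left_mem_Icc.2 zero_le_one) ⟨hs0, hs1⟩ hs0
  norm_num at h
  linarith

/-- The squared relative difference of two nonnegative numbers, weighted by the `p`-th power of
their mean, is comparable to the gap in Jensen's inequality for `x ↦ x ^ p`. -/
lemma exists_jensen_gap_comparable {p : ℝ} (hp : 1 < p) :
    ∃ c C : ℝ, 0 < c ∧ 0 < C ∧ ∀ x y : ℝ, 0 ≤ x → 0 ≤ y →
      c * ((x ^ p + y ^ p) / 2 - ((x + y) / 2) ^ p) ≤
          ((x - y) / ((x + y) / 2)) ^ 2 * ((x + y) / 2) ^ p ∧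
        ((x - y) / ((x + y) / 2)) ^ 2 * ((x + y) / 2) ^ p ≤
          C * ((x ^ p + y ^ p) / 2 - ((x + y) / 2) ^ p) := by
  have hq : 0 < p - 1 := by linarith
  refine ⟨16 / (p * ((2 : ℝ) ^ (p - 1) + p)), 16 / (p * (p - 1)), by positivity, by positivity,
    fun x y hx hy => ?_⟩
  wlog hxy : y ≤ x generalizing x y
  · have h := this y x hy hx (le_of_not_ge hxy)
    rwa [add_comm y x, add_comm (y ^ p), ← neg_sub x y, neg_div, neg_sq] at h
  rcases (add_nonneg hx hy).eq_or_lt with h0 | h0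
  · obtain rfl : x = 0 := by linarith
    obtain rfl : y = 0 := by linarith
    simp [zero_rpow (by linarith : p ≠ 0)]
  set m := (x + y) / 2 with hm
  have hm0 : 0 < m := by positivity
  set s := (x - y) / (2 * m) with hs
  have hs0 : 0 ≤ s := div_nonneg (by linarith) (by linarith)
  have hs1 : s ≤ 1 := by rw [hs, div_le_one (by positivity)]; linarith
  have hxs : x = m * (1 + s) := by rw [hs]; field_simp; linarith
  have hys : y = m * (1 - s) := by rw [hs]; field_simp; linarith
  have hT : (x - y) / m = 2 * s := by rw [hs]; field_simp
  rw [hT, hxs, hys, mul_rpow hm0.le (by linarith), mul_rpow hm0.le (by linarith)]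
  have h1 := le_rpow_one_add_add_rpow_one_sub hp hs0 hs1
  have h2 := rpow_one_add_add_rpow_one_sub_le hp hs0 hs1
  have hmp : 0 < m ^ p := by positivity
  set u := (1 + s) ^ p
  set v := (1 - s) ^ p
  have hK : 0 < p * ((2 : ℝ) ^ (p - 1) + p) := by positivity
  have hL : 0 < p * (p - 1) := by positivity
  set K := p * ((2 : ℝ) ^ (p - 1) + p)
  set L := p * (p - 1)
  constructor
  · rw [div_mul_eq_mul_div, div_le_iff₀ hK]
    nlinarith [mul_le_mul_of_nonneg_left h2 hmp.le]
  · rw [div_mul_eq_mul_div, le_div_iff₀ hL]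
    nlinarith [mul_le_mul_of_nonneg_left h1 hmp.le]

lemma avg_eq_setAverage (w : ℝ → ℝ) {a b : ℝ} (hab : a ≤ b) :
    avg w a b = ⨍ x in Set.Icc a b, w x := by
  rw [avg, setAverage_eq, integral_Icc_eq_integral_Ioc, intervalIntegral.integral_of_le hab,
    Real.volume_real_Icc_of_le hab, smul_eq_mul]

lemma avg_nonneg {w : ℝ → ℝ} (hw : ∀ᵐ x : ℝ, 0 ≤ w x) {a b : ℝ} (hab : a ≤ b) :
    0 ≤ avg w a b :=
  mul_nonneg (inv_nonneg.2 (sub_nonneg.2 hab))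
    (intervalIntegral.integral_nonneg_of_ae hab hw)

lemma MeasureTheory.LocallyIntegrable.intervalIntegrable_of_le {w : ℝ → ℝ}
    (hw : LocallyIntegrable w volume) {a b : ℝ} (hab : a ≤ b) :
    IntervalIntegrable w volume a b :=
  (intervalIntegrable_iff_integrableOn_Icc_of_le hab).2 (hw.integrableOn_isCompact isCompact_Icc)

lemma avg_eq_avg_halves {w : ℝ → ℝ} (hw : LocallyIntegrable w volume) {a b : ℝ} (hab : a < b) :
    avg w a b = (avg w a (mid a b) + avg w (mid a b) b) / 2 := by
  have hm1 : a < mid a b := by unfold mid; linarith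
  have hm2 : mid a b < b := by unfold mid; linarith
  have h := intervalIntegral.integral_add_adjacent_intervals
    (hw.intervalIntegrable_of_le hm1.le) (hw.intervalIntegrable_of_le hm2.le)
  have h0 : b - a ≠ 0 := by linarith
  simp only [avg]
  rw [← h, show mid a b - a = (b - a) / 2 by unfold mid; ring,
    show b - mid a b = (b - a) / 2 by unfold mid; ring]
  field_simp

lemma avg_rpow_le_avg {w : ℝ → ℝ} (hw : LocallyIntegrable w volume) (hw0 : ∀ᵐ x : ℝ, 0 ≤ w x)
    {p : ℝ} (hp : 1 ≤ p) {a b : ℝ} (hab : a < b)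
    (hwp : IntervalIntegrable (fun x => w x ^ p) volume a b) :
    avg w a b ^ p ≤ avg (fun x => w x ^ p) a b := by
  rw [avg_eq_setAverage _ hab.le, avg_eq_setAverage _ hab.le]
  refine (convexOn_rpow hp).map_set_average_le
    (continuousOn_id.rpow_const fun x _ => Or.inr (by linarith)) isClosed_Ici ?_ ?_
    (ae_restrict_of_ae hw0) (hw.integrableOn_isCompact isCompact_Icc)
    ((intervalIntegrable_iff_integrableOn_Icc_of_le hab.le).1 hwp)
  · simpa using hab
  · simp

lemma subInt_snd (a b : ℝ) (n k : ℕ) : (subInt a b n k).2 = (subInt a b n (k + 1)).1 := by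
  simp [subInt]

lemma subInt_snd_sub_fst (a b : ℝ) (n k : ℕ) :
    (subInt a b n k).2 - (subInt a b n k).1 = (b - a) / 2 ^ n := by
  simp only [subInt]; ring

lemma subInt_fst_zero (a b : ℝ) (n : ℕ) : (subInt a b n 0).1 = a := by simp [subInt]

lemma subInt_fst_two_pow (a b : ℝ) (n : ℕ) : (subInt a b n (2 ^ n)).1 = b := by
  simp only [subInt]; push_cast; field_simp; ring

lemma subInt_fst_mono {a b : ℝ} (hab : a ≤ b) (n : ℕ) : Monotone fun k => (subInt a b n k).1 := by
  intro k l hkl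
  have : 0 ≤ (b - a) / 2 ^ n := div_nonneg (sub_nonneg.2 hab) (by positivity)
  have : (k : ℝ) ≤ l := by exact_mod_cast hkl
  simp only [subInt]
  gcongr

lemma Finset.sum_range_two_mul_eq {M : Type*} [AddCommMonoid M] (f : ℕ → M) (m : ℕ) :
    ∑ i ∈ Finset.range (2 * m), f i = ∑ i ∈ Finset.range m, (f (2 * i) + f (2 * i + 1)) := by
  induction m with
  | zero => simp
  | succ m ih =>
    rw [mul_add, mul_one, Finset.sum_range_succ, Finset.sum_range_succ, ih,
      Finset.sum_range_succ, add_assoc]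

/-- `Σ ⟨w⟩_I ^ p |I|` over the intervals `I` of bisection level `n` of `[a,b]`. -/
def levelPowSum (p : ℝ) (w : ℝ → ℝ) (a b : ℝ) (n : ℕ) : ℝ :=
  ∑ k ∈ Finset.range (2 ^ n),
    avg w (subInt a b n k).1 (subInt a b n k).2 ^ p * ((b - a) / 2 ^ n)

lemma levelPowSum_zero (p : ℝ) (w : ℝ → ℝ) (a b : ℝ) :
    levelPowSum p w a b 0 = avg w a b ^ p * (b - a) := by
  simp [levelPowSum, subInt]

lemma levelPowSum_succ_sub (p : ℝ) (w : ℝ → ℝ) (a b : ℝ) (n : ℕ) :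
    levelPowSum p w a b (n + 1) - levelPowSum p w a b n =
      ∑ k ∈ Finset.range (2 ^ n),
        ((avg w (subInt a b n k).1 (mid (subInt a b n k).1 (subInt a b n k).2) ^ p +
          avg w (mid (subInt a b n k).1 (subInt a b n k).2) (subInt a b n k).2 ^ p) / 2 -
          avg w (subInt a b n k).1 (subInt a b n k).2 ^ p) * ((b - a) / 2 ^ n) := by
  rw [levelPowSum, levelPowSum, pow_succ' 2 n, Finset.sum_range_two_mul_eq,
    ← Finset.sum_sub_distrib]
  refine Finset.sum_congr rfl fun k _ => ?_
  rw [subInt_succ_two_mul, subInt_succ_two_mul_add_one]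
  field_simp
  ring

lemma levelPowSum_le_integral {w : ℝ → ℝ} (hw : LocallyIntegrable w volume)
    (hw0 : ∀ᵐ x : ℝ, 0 ≤ w x) {p : ℝ} (hp : 1 ≤ p) {a b : ℝ} (hab : a < b)
    (hwp : IntervalIntegrable (fun x => w x ^ p) volume a b) (n : ℕ) :
    levelPowSum p w a b n ≤ ∫ x in a..b, w x ^ p := by
  have hmono := subInt_fst_mono hab.le n
  have hint (k : ℕ) (hk : k < 2 ^ n) : IntervalIntegrable (fun x => w x ^ p) volume
      (subInt a b n k).1 (subInt a b n (k + 1)).1 := by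
    refine hwp.mono_set ?_
    rw [Set.uIcc_of_le hab.le, Set.uIcc_of_le (hmono k.le_succ)]
    refine Set.Icc_subset_Icc ?_ ?_
    · simpa only [subInt_fst_zero] using hmono k.zero_le
    · simpa only [subInt_fst_two_pow] using hmono (Nat.succ_le_of_lt hk)
  have hsum := intervalIntegral.sum_integral_adjacent_intervals
    (a := fun k => (subInt a b n k).1) hint
  simp only [subInt_fst_zero, subInt_fst_two_pow] at hsum
  rw [← hsum, levelPowSum]
  refine Finset.sum_le_sum fun k hk => ?_
  have hlt := subInt_fst_lt_snd hab n k
  have h := avg_rpow_le_avg hw hw0 hp hlt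
    (by rw [subInt_snd]; exact hint k (Finset.mem_range.1 hk))
  have hpos : 0 < (b - a) / 2 ^ n := subInt_snd_sub_fst a b n k ▸ sub_pos.2 hlt
  rw [avg.eq_1 (fun x => w x ^ p), subInt_snd_sub_fst, ← subInt_snd] at *
  calc _ ≤ _ := mul_le_mul_of_nonneg_right h hpos.le
    _ = _ := by rw [mul_comm, mul_inv_cancel_left₀ hpos.ne']

open Filter Topology in
lemma ae_tendsto_avg_subInt {w : ℝ → ℝ} (hw : LocallyIntegrable w volume) {a b : ℝ}
    (hab : a < b) :
    ∀ᵐ x : ℝ, ∀ k : ℕ → ℕ,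
      (∀ n, x ∈ Set.Ico (subInt a b n (k n)).1 (subInt a b n (k n)).2) →
        Tendsto (fun n => avg w (subInt a b n (k n)).1 (subInt a b n (k n)).2) atTop
          (𝓝 (w x)) := by
  filter_upwards [IsUnifLocDoublingMeasure.ae_tendsto_average volume hw 1] with x hx k hk
  have hδ : Tendsto (fun n : ℕ => (b - a) / 2 ^ n / 2) atTop (𝓝[>] 0) := by
    refine tendsto_nhdsWithin_iff.2 ⟨?_, .of_forall fun n => ?_⟩
    · have := (tendsto_inv_atTop_zero.comp
        (tendsto_pow_atTop_atTop_of_one_lt (one_lt_two : (1 : ℝ) < 2))).const_mul ((b - a) / 2)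
      rw [mul_zero] at this
      refine this.congr fun n => ?_
      simp only [Function.comp]
      field_simp
    · have := sub_pos.2 hab
      simp only [Set.mem_Ioi]
      positivity
  have hball (n : ℕ) : Set.Icc (subInt a b n (k n)).1 (subInt a b n (k n)).2 =
      Metric.closedBall (((subInt a b n (k n)).1 + (subInt a b n (k n)).2) / 2)
        ((b - a) / 2 ^ n / 2) := by
    rw [Real.Icc_eq_closedBall, subInt_snd_sub_fst]
  refine (hx (fun n => ((subInt a b n (k n)).1 + (subInt a b n (k n)).2) / 2) _ hδ
    (.of_forall fun n => ?_)).congr fun n => ?_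
  · rw [one_mul, ← hball]
    exact Set.Ico_subset_Icc_self (hk n)
  · rw [avg_eq_setAverage _ (subInt_fst_lt_snd hab _ _).le, hball]

lemma exists_mem_subInt {a b x : ℝ} (hx : x ∈ Set.Ico a b) (n : ℕ) :
    ∃ k < 2 ^ n, x ∈ Set.Ico (subInt a b n k).1 (subInt a b n k).2 := by
  have hpos : 0 < (b - a) / 2 ^ n := div_pos (by linarith [hx.1, hx.2]) (by positivity)
  have h0 : 0 ≤ (x - a) / ((b - a) / 2 ^ n) := div_nonneg (by linarith [hx.1]) hpos.le
  refine ⟨⌊(x - a) / ((b - a) / 2 ^ n)⌋₊, ?_, ?_, ?_⟩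
  · rw [Nat.floor_lt h0, div_lt_iff₀ hpos]
    push_cast
    rw [mul_div_cancel₀ _ (by positivity)]
    linarith [hx.2]
  · have := (le_div_iff₀ hpos).1 (Nat.floor_le h0)
    simp only [subInt]
    linarith
  · have := (div_lt_iff₀ hpos).1 (Nat.lt_floor_add_one ((x - a) / ((b - a) / 2 ^ n)))
    simp only [subInt]
    linarith

lemma eq_of_mem_subInt {a b x : ℝ} (hab : a ≤ b) {n k l : ℕ}
    (hk : x ∈ Set.Ico (subInt a b n k).1 (subInt a b n k).2)
    (hl : x ∈ Set.Ico (subInt a b n l).1 (subInt a b n l).2) : k = l := by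
  by_contra hne
  rw [subInt_snd] at hk hl
  exact Set.disjoint_left.1 ((subInt_fst_mono hab n).pairwise_disjoint_on_Ico_succ hne) hk hl

open Filter Topology in
lemma integral_rpow_le_of_forall_levelPowSum_le {w : ℝ → ℝ} (hw : LocallyIntegrable w volume)
    (hw0 : ∀ᵐ x : ℝ, 0 ≤ w x) {p : ℝ} (hp : 0 ≤ p) {a b : ℝ} (hab : a < b)
    (hwp : IntervalIntegrable (fun x => w x ^ p) volume a b) {M : ℝ}
    (hM : ∀ n, levelPowSum p w a b n ≤ M) :
    ∫ x in a..b, w x ^ p ≤ M := by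
  have havg (n k : ℕ) : 0 ≤ avg w (subInt a b n k).1 (subInt a b n k).2 ^ p :=
    rpow_nonneg (avg_nonneg hw0 (subInt_fst_lt_snd hab n k).le) p
  have hh (n : ℕ) : 0 ≤ (b - a) / 2 ^ n := div_nonneg (sub_nonneg.2 hab.le) (by positivity)
  have hM0 : 0 ≤ M := (Finset.sum_nonneg fun k _ => mul_nonneg (havg 0 k) (hh 0)).trans (hM 0)
  set f : ℕ → ℝ → ℝ≥0∞ := fun n x => ∑ k ∈ Finset.range (2 ^ n),
    (Set.Ico (subInt a b n k).1 (subInt a b n k).2).indicator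
      (fun _ => ENNReal.ofReal (avg w (subInt a b n k).1 (subInt a b n k).2 ^ p)) x with hf
  have hfmeas (n : ℕ) : Measurable (f n) :=
    Finset.measurable_fun_sum _ fun k _ => measurable_const.indicator measurableSet_Ico
  have hfint (n : ℕ) : ∫⁻ x in Set.Ico a b, f n x ≤ ENNReal.ofReal M := by
    calc ∫⁻ x in Set.Ico a b, f n x ≤ ∫⁻ x, f n x := setLIntegral_le_lintegral _ _
      _ = ENNReal.ofReal (levelPowSum p w a b n) := by
        rw [hf, lintegral_finsetSum _ fun k _ => measurable_const.indicator measurableSet_Ico,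
          levelPowSum, ENNReal.ofReal_sum_of_nonneg fun k _ => mul_nonneg (havg n k) (hh n)]
        refine Finset.sum_congr rfl fun k _ => ?_
        rw [lintegral_indicator_const measurableSet_Ico, Real.volume_Ico, subInt_snd_sub_fst,
          ENNReal.ofReal_mul (havg n k)]
      _ ≤ ENNReal.ofReal M := ENNReal.ofReal_le_ofReal (hM n)
  have hlim : ∀ᵐ x ∂volume.restrict (Set.Ico a b),
      ENNReal.ofReal (w x ^ p) = liminf (fun n => f n x) atTop := by
    filter_upwards [ae_restrict_of_ae (ae_tendsto_avg_subInt hw hab),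
      ae_restrict_mem measurableSet_Ico] with x hx hxab
    choose k hk2 hk using exists_mem_subInt hxab
    have hfx (n : ℕ) : f n x =
        ENNReal.ofReal (avg w (subInt a b n (k n)).1 (subInt a b n (k n)).2 ^ p) := by
      rw [hf]
      dsimp only
      rw [Finset.sum_eq_single_of_mem (k n) (Finset.mem_range.2 (hk2 n)),
        Set.indicator_of_mem (hk n)]
      exact fun l _ hl => Set.indicator_of_notMem
        (fun hxl => hl (eq_of_mem_subInt hab.le hxl (hk n))) _
    simp only [hfx]
    exact (ENNReal.tendsto_ofReal ((hx k hk).rpow_const (Or.inr hp))).liminf_eq.symm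
  have hle : ∫⁻ x in Set.Ico a b, ENNReal.ofReal (w x ^ p) ≤ ENNReal.ofReal M := by
    rw [lintegral_congr_ae hlim]
    exact (lintegral_liminf_le hfmeas).trans
      (liminf_le_of_frequently_le' (Frequently.of_forall hfint))
  rw [intervalIntegral.integral_of_le hab.le, ← integral_Ico_eq_integral_Ioc]
  rw [← ofReal_integral_eq_lintegral_ofReal
    ((intervalIntegrable_iff_integrableOn_Ico_of_le hab.le).1 hwp)
    (ae_restrict_of_ae (hw0.mono fun x hx => rpow_nonneg hx p))] at hle
  exact (ENNReal.ofReal_le_ofReal_iff hM0).1 hle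

/-- Theorem II.6, case `A(x) = x^p`. -/
theorem buckleySum_comparable_rpow (p : ℝ) (hp : 1 < p) :
    ∃ c C : ℝ, 0 < c ∧ 0 < C ∧ ∀ w : ℝ → ℝ, IsWeight w → ∀ a b : ℝ, a < b →
      IntervalIntegrable (fun x => w x ^ p) volume a b →
      c * (avg (fun x => w x ^ p) a b - avg w a b ^ p) ≤
          buckleySum w a b (fun x => x ^ p) ∧
        buckleySum w a b (fun x => x ^ p) ≤
          C * (avg (fun x => w x ^ p) a b - avg w a b ^ p) := by
  obtain ⟨c, C, hc, hC, hcC⟩ := exists_jensen_gap_comparable hp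
  refine ⟨c, C, hc, hC, fun w ⟨hw, hwpos⟩ a b hab hwp => ?_⟩
  have hw0 : ∀ᵐ x : ℝ, 0 ≤ w x := hwpos.mono fun x hx => hx.le
  have hba : 0 < b - a := sub_pos.2 hab
  set T : ℕ → ℝ := fun n => ∑ k ∈ Finset.range (2 ^ n),
    (delta w (subInt a b n k).1 (subInt a b n k).2 /
        avg w (subInt a b n k).1 (subInt a b n k).2) ^ 2 *
      avg w (subInt a b n k).1 (subInt a b n k).2 ^ p * ((b - a) / 2 ^ n) with hT
  set E := levelPowSum p w a b with hE
  set I := ∫ x in a..b, w x ^ p with hI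
  have hT0 (n : ℕ) : 0 ≤ T n := Finset.sum_nonneg fun k _ => mul_nonneg
    (mul_nonneg (sq_nonneg _)
      (rpow_nonneg (avg_nonneg hw0 (subInt_fst_lt_snd hab n k).le) p))
    (div_nonneg hba.le (by positivity))
  have hlevel (n : ℕ) : c * (E (n + 1) - E n) ≤ T n ∧ T n ≤ C * (E (n + 1) - E n) := by
    rw [hE, levelPowSum_succ_sub, Finset.mul_sum, Finset.mul_sum]
    have key (k : ℕ) := by
      have hlt := subInt_fst_lt_snd hab n k
      exact hcC _ _
        (avg_nonneg hw0 (a := (subInt a b n k).1)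
          (b := mid (subInt a b n k).1 (subInt a b n k).2) (by unfold mid; linarith))
        (avg_nonneg hw0 (a := mid (subInt a b n k).1 (subInt a b n k).2)
          (b := (subInt a b n k).2) (by unfold mid; linarith))
    simp only [← avg_eq_avg_halves hw (subInt_fst_lt_snd hab n _), ← delta.eq_1] at key
    have hh : 0 ≤ (b - a) / 2 ^ n := by positivity
    constructor <;> refine Finset.sum_le_sum fun k _ => ?_ <;> rw [← mul_assoc]
    · exact mul_le_mul_of_nonneg_right (key k).1 hh
    · exact mul_le_mul_of_nonneg_right (key k).2 hh
  have hlow (n : ℕ) : c * (E n - E 0) ≤ ∑ i ∈ Finset.range n, T i := by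
    rw [← Finset.sum_range_sub, Finset.mul_sum]
    exact Finset.sum_le_sum fun i _ => (hlevel i).1
  have hupp (n : ℕ) : ∑ i ∈ Finset.range n, T i ≤ C * (I - E 0) := by
    refine (Finset.sum_le_sum fun i _ => (hlevel i).2).trans ?_
    rw [← Finset.mul_sum, Finset.sum_range_sub]
    gcongr
    exact levelPowSum_le_integral hw hw0 hp.le hab hwp n
  have hsum : Summable T := summable_of_sum_range_le hT0 hupp
  have htsum : c * (I - E 0) ≤ ∑' n, T n := by
    have h : I ≤ E 0 + (∑' n, T n) / c := by
      refine integral_rpow_le_of_forall_levelPowSum_le hw hw0 (by linarith) hab hwp fun n => ?_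
      rw [← sub_le_iff_le_add', le_div_iff₀' hc]
      exact (hlow n).trans (hsum.sum_le_tsum _ fun i _ => hT0 i)
    rwa [← sub_le_iff_le_add', le_div_iff₀' hc] at h
  have hgap : avg (fun x => w x ^ p) a b - avg w a b ^ p = (b - a)⁻¹ * (I - E 0) := by
    rw [hE, levelPowSum_zero, avg.eq_1 (fun x => w x ^ p), mul_sub, mul_comm (_ ^ p),
      inv_mul_cancel_left₀ hba.ne']
  have hS : buckleySum w a b (fun x => x ^ p) = (b - a)⁻¹ * ∑' n, T n := rfl
  rw [hgap, hS, mul_left_comm, mul_left_comm C]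
  exact ⟨mul_le_mul_of_nonneg_left htsum (by positivity),
    mul_le_mul_of_nonneg_left (Real.tsum_le_of_sum_range_le hT0 hupp) (by positivity)⟩
end
end
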